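/- Let 𝒜 = H_0 + 𝒜_0 be a real affine space of self-adjoint operators on a Hilbert space ℋ over a real normed vector space 𝒜_0 of bounded self-adjoint perturbations, such that any two operators from 𝒜 are resolvent comparable and the norm ‖·‖_F of 𝒜_0 satisfies ‖V‖_F ≥ c‖R_z(H) V R_z(H)‖_1 for some constant c > 0, some H ∈ 𝒜 and some nonreal z. Let H_0, H_1 ∈ 𝒜, let φ ∈ C_c^∞(ℝ) be real-valued, and let ξ and ξ_φ denote the spectral shift measures of the pairs (H_1, H_0) and (φ(H_1), φ(H_0)) respectively. Then the invariance principle ξ_φ(f) = ξ((f ∘ φ) · φ') holds for every bounded Borel function f. -/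

import Mathlib

open MeasureTheory Filter Complex Set Topology
open scoped InnerProductSpace ComplexInnerProductSpace ENNReal Topology Real
set_option autoImplicit false

noncomputable section

namespace SSF

variable {𝓗 : Type*} {𝓚 : Type*}

section TraceClass

variable [NormedAddCommGroup 𝓗] [InnerProductSpace ℂ 𝓗]
variable [NormedAddCommGroup 𝓚] [InnerProductSpace ℂ 𝓚]

/-- A bounded operator `T` on a Hilbert space is trace class iff the sums
`∑ |⟪e i, T (f i)⟫|` over finite orthonormal families `e,f` are uniformly bounded. -/
def IsTraceClass (T : 𝓗 →L[ℂ] 𝓗) : Prop :=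
  ∃ C : ℝ, ∀ (n : ℕ) (e f : Fin n → 𝓗), Orthonormal ℂ e → Orthonormal ℂ f →
    ∑ i, ‖⟪e i, T (f i)⟫_ℂ‖ ≤ C

/-- The trace norm of a bounded operator: the supremum of `∑ |⟪e i, T (f i)⟫|` over
finite orthonormal families `e,f`. -/
def traceNorm (T : 𝓗 →L[ℂ] 𝓗) : ℝ :=
  sSup {c : ℝ | ∃ (n : ℕ) (e f : Fin n → 𝓗), Orthonormal ℂ e ∧ Orthonormal ℂ f ∧
    c = ∑ i, ‖⟪e i, T (f i)⟫_ℂ‖}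

/-- The trace of a bounded operator, computed in a Hilbert basis (meaningful for
trace class operators). -/
def trace [CompleteSpace 𝓗] (T : 𝓗 →L[ℂ] 𝓗) : ℂ :=
  ∑' i : (exists_hilbertBasis ℂ 𝓗).choose, ⟪(i : 𝓗), T (i : 𝓗)⟫_ℂ

/-- A bounded operator between Hilbert spaces is Hilbert-Schmidt iff the sums
`∑ ‖T (e i)‖ ^ 2` over finite orthonormal families are uniformly bounded. -/
def IsHilbertSchmidt (T : 𝓗 →L[ℂ] 𝓚) : Prop :=
  ∃ C : ℝ, ∀ (n : ℕ) (e : Fin n → 𝓗), Orthonormal ℂ e → ∑ i, ‖T (e i)‖ ^ 2 ≤ C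

end TraceClass

variable [NormedAddCommGroup 𝓗] [InnerProductSpace ℂ 𝓗] [CompleteSpace 𝓗]
variable [NormedAddCommGroup 𝓚] [InnerProductSpace ℂ 𝓚] [CompleteSpace 𝓚]

/-- A (possibly unbounded) self-adjoint operator on a Hilbert space, bundled together
with its resolvent `R_z = (H - z)⁻¹` at every nonreal `z`. -/
structure SelfAdjointOperator (𝓗 : Type*) [NormedAddCommGroup 𝓗]
    [InnerProductSpace ℂ 𝓗] [CompleteSpace 𝓗] where
  domain : Submodule ℂ 𝓗
  dense_domain : Dense (domain : Set 𝓗)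
  op : domain →ₗ[ℂ] 𝓗
  symmetric : ∀ f g : domain, ⟪op f, (g : 𝓗)⟫_ℂ = ⟪(f : 𝓗), op g⟫_ℂ
  resolvent : ℂ → (𝓗 →L[ℂ] 𝓗)
  resolvent_mem : ∀ z : ℂ, z.im ≠ 0 → ∀ f : 𝓗, resolvent z f ∈ domain
  resolvent_right : ∀ (z : ℂ) (hz : z.im ≠ 0) (f : 𝓗),
    op ⟨resolvent z f, resolvent_mem z hz f⟩ - z • resolvent z f = f
  resolvent_left : ∀ (z : ℂ), z.im ≠ 0 → ∀ g : domain,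
    resolvent z (op g - z • (g : 𝓗)) = (g : 𝓗)

/-- `IsSum H0 V H1` encodes the relation `H1 = H0 + V` for a bounded perturbation `V`,
via the second resolvent identity (which characterises it uniquely). -/
def IsSum (H0 : SelfAdjointOperator 𝓗) (V : 𝓗 →L[ℂ] 𝓗)
    (H1 : SelfAdjointOperator 𝓗) : Prop :=
  ∀ z : ℂ, z.im ≠ 0 →
    H1.resolvent z - H0.resolvent z = -(H1.resolvent z ∘L (V ∘L H0.resolvent z))

/-- Two self-adjoint operators are resolvent comparable if the difference of their
resolvents at some (hence any) nonreal point is trace class. -/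
def ResolventComparable (H0 H1 : SelfAdjointOperator 𝓗) : Prop :=
  ∃ z : ℂ, z.im ≠ 0 ∧ IsTraceClass (H1.resolvent z - H0.resolvent z)

/-- The spectral measure of a self-adjoint operator `H`, bundled with the associated
scalar spectral measures, the Borel functional calculus, and the decomposition into
absolutely continuous and singular parts. -/
structure SpectralMeasure (H : SelfAdjointOperator 𝓗) where
  proj : Set ℝ → (𝓗 →L[ℂ] 𝓗)
  proj_sa : ∀ s, IsSelfAdjoint (proj s)
  proj_mul : ∀ s t, proj (s ∩ t) = proj s ∘L proj t
  proj_univ : proj Set.univ = 1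
  scalar : 𝓗 → Measure ℝ
  scalar_finite : ∀ f, IsFiniteMeasure (scalar f)
  scalar_spec : ∀ (f : 𝓗) (s : Set ℝ), MeasurableSet s →
    (scalar f s).toReal = (⟪f, proj s f⟫_ℂ).re
  resolvent_spec : ∀ (z : ℂ), z.im ≠ 0 → ∀ f : 𝓗,
    ⟪f, H.resolvent z f⟫_ℂ = ∫ x : ℝ, ((x : ℂ) - z)⁻¹ ∂(scalar f)
  fc : (ℝ → ℂ) → (𝓗 →L[ℂ] 𝓗)
  fc_spec : ∀ (φ : ℝ → ℂ), Measurable φ → (∃ C, ∀ x, ‖φ x‖ ≤ C) →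
    ∀ f : 𝓗, ⟪f, fc φ f⟫_ℂ = ∫ x : ℝ, φ x ∂(scalar f)
  acProj : Set ℝ → (𝓗 →L[ℂ] 𝓗)
  sProj : Set ℝ → (𝓗 →L[ℂ] 𝓗)
  acProj_add_sProj : ∀ s, acProj s + sProj s = proj s
  acScalar : 𝓗 → Measure ℝ
  sScalar : 𝓗 → Measure ℝ
  acScalar_spec : ∀ (f : 𝓗) (s : Set ℝ), MeasurableSet s →
    (acScalar f s).toReal = (⟪f, acProj s f⟫_ℂ).re
  sScalar_spec : ∀ (f : 𝓗) (s : Set ℝ), MeasurableSet s →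
    (sScalar f s).toReal = (⟪f, sProj s f⟫_ℂ).re
  acScalar_ac : ∀ f, acScalar f ≪ MeasureTheory.volume
  sScalar_sing : ∀ f, (sScalar f).MutuallySingular MeasureTheory.volume

/-- The real-valued test function version of the functional calculus. -/
def SpectralMeasure.fcR {H : SelfAdjointOperator 𝓗} (E : SpectralMeasure H)
    (φ : ℝ → ℝ) : 𝓗 →L[ℂ] 𝓗 :=
  E.fc fun x => (φ x : ℂ)


/-- `γ` has derivative `dγ r` at `r`, with respect to the norm function `nF`. -/
def HasPathDerivAt (nF : (𝓗 →L[ℂ] 𝓗) → ℝ) (γ dγ : ℝ → (𝓗 →L[ℂ] 𝓗)) (r : ℝ) : Prop :=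
  Tendsto (fun h : ℝ => nF ((((h : ℂ))⁻¹) • (γ (r + h) - γ r) - dγ r))
    (𝓝[≠] (0 : ℝ)) (𝓝 0)

/-- `γ` is a `C¹` path with derivative `dγ`, with respect to the norm function `nF`. -/
def IsC1Path (nF : (𝓗 →L[ℂ] 𝓗) → ℝ) (γ dγ : ℝ → (𝓗 →L[ℂ] 𝓗)) : Prop :=
  (∀ r : ℝ, HasPathDerivAt nF γ dγ r) ∧
  (∀ r : ℝ, Tendsto (fun s : ℝ => nF (dγ s - dγ r)) (𝓝 r) (𝓝 0))

/-- `γ` is a piecewise `C¹` path with derivative `dγ` (off a finite set),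
with respect to the norm function `nF`. -/
def IsPiecewiseC1Path (nF : (𝓗 →L[ℂ] 𝓗) → ℝ) (γ dγ : ℝ → (𝓗 →L[ℂ] 𝓗)) : Prop :=
  (∀ r : ℝ, Tendsto (fun s : ℝ => nF (γ s - γ r)) (𝓝 r) (𝓝 0)) ∧
  ∃ P : Finset ℝ, ∀ r ∉ P, HasPathDerivAt nF γ dγ r

/-- The setting of Section 2: a real affine space `𝒜 = H₀ + 𝒜₀` of self-adjoint
operators, over a real normed vector space `𝒜₀` of bounded self-adjoint perturbations,
such that any two operators of `𝒜` are resolvent comparable and the norm `nF` of `𝒜₀`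
dominates `V ↦ ‖R_z(H) V R_z(H)‖₁`.  The affine space is realised by the map
`opOf : V ↦ H₀ + V` (with `H₀ = opOf 0`), encoded via the second resolvent identity. -/
structure AffineSetting (𝓗 : Type*) [NormedAddCommGroup 𝓗] [InnerProductSpace ℂ 𝓗]
    [CompleteSpace 𝓗] where
  A0 : Set (𝓗 →L[ℂ] 𝓗)
  zero_mem : 0 ∈ A0
  add_mem : ∀ {V W}, V ∈ A0 → W ∈ A0 → V + W ∈ A0
  neg_mem : ∀ {V}, V ∈ A0 → -V ∈ A0
  smul_mem : ∀ (a : ℝ) {V}, V ∈ A0 → (a : ℂ) • V ∈ A0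
  sa_mem : ∀ V ∈ A0, IsSelfAdjoint V
  nF : (𝓗 →L[ℂ] 𝓗) → ℝ
  nF_nonneg : ∀ V, 0 ≤ nF V
  nF_eq_zero : ∀ V ∈ A0, (nF V = 0 ↔ V = 0)
  nF_smul : ∀ (a : ℝ) (V), nF ((a : ℂ) • V) = |a| * nF V
  nF_add : ∀ V W, nF (V + W) ≤ nF V + nF W
  opOf : (𝓗 →L[ℂ] 𝓗) → SelfAdjointOperator 𝓗
  opOf_spec : ∀ V ∈ A0, IsSum (opOf 0) V (opOf V)
  comparable : ∀ V ∈ A0, ∀ W ∈ A0, ResolventComparable (opOf V) (opOf W)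
  nF_dominates : ∃ c : ℝ, 0 < c ∧ ∃ V₀ ∈ A0, ∃ z : ℂ, z.im ≠ 0 ∧
    ∀ V ∈ A0, c * traceNorm ((opOf V₀).resolvent z ∘L (V ∘L (opOf V₀).resolvent z)) ≤ nF V

/-- The infinitesimal spectral shift measure
`Φ_H(V)(φ) = Tr(E_H(supp φ) V φ(H))`, as a real number. -/
def PhiMeas {H : SelfAdjointOperator 𝓗} (E : SpectralMeasure H)
    (V : 𝓗 →L[ℂ] 𝓗) (φ : ℝ → ℝ) : ℝ :=
  (trace (E.proj (tsupport φ) ∘L (V ∘L E.fcR φ))).re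

/-- The absolutely continuous part of the infinitesimal spectral shift measure,
`Φ^{(a)}_H(V)(φ) = Tr(E^{(a)}_H(supp φ) V φ(H))`. -/
def PhiMeasAC {H : SelfAdjointOperator 𝓗} (E : SpectralMeasure H)
    (V : 𝓗 →L[ℂ] 𝓗) (φ : ℝ → ℝ) : ℝ :=
  (trace (E.acProj (tsupport φ) ∘L (V ∘L E.fcR φ))).re

/-- The singular part of the infinitesimal spectral shift measure,
`Φ^{(s)}_H(V)(φ) = Tr(E^{(s)}_H(supp φ) V φ(H))`. -/
def PhiMeasS {H : SelfAdjointOperator 𝓗} (E : SpectralMeasure H)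
    (V : 𝓗 →L[ℂ] 𝓗) (φ : ℝ → ℝ) : ℝ :=
  (trace (E.sProj (tsupport φ) ∘L (V ∘L E.fcR φ))).re

/-- `A` is the (everywhere defined) self-adjoint operator given by the bounded
self-adjoint operator `T`. -/
def IsBoundedSAOpOf (A : SelfAdjointOperator 𝓗) (T : 𝓗 →L[ℂ] 𝓗) : Prop :=
  A.domain = ⊤ ∧ ∀ f : A.domain, A.op f = T (f : 𝓗)

/-- The Cayley transform `x ↦ (1 + ix) / (1 - ix)` of the real line onto the unit circle. -/
def cayley (x : ℝ) : ℂ := -1 + 2 * I * ((x : ℂ) - (-I))⁻¹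

lemma ofReal_sub_ne_zero (x : ℝ) {z : ℂ} (hz : z.im ≠ 0) : (x : ℂ) - z ≠ 0 := by
  intro h
  apply hz
  have := congrArg Complex.im h
  simpa using this

lemma ofReal_sub_neg_I_ne_zero (x : ℝ) : (x : ℂ) - (-I) ≠ 0 :=
  ofReal_sub_ne_zero x (by simp)

lemma one_add_sq_eq (x : ℝ) : (1 + (x : ℂ) ^ 2) = ((x : ℂ) - (-I)) * (x - I) := by
  linear_combination I_sq

lemma cayley_eq_exp (x : ℝ) : cayley x = Complex.exp (I * (2 * Real.arctan x : ℝ)) := by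
  have h1 : Complex.exp (I * (2 * Real.arctan x : ℝ)) = Complex.exp (Real.arctan x * I) ^ 2 := by
    rw [← Complex.exp_nat_mul]
    congr 1
    push_cast
    ring
  have hs : ((√(1 + x ^ 2) : ℝ) : ℂ) ^ 2 = 1 + (x : ℂ) ^ 2 := by
    norm_cast
    rw [Real.sq_sqrt (by positivity)]
  have hs0 : ((√(1 + x ^ 2) : ℝ) : ℂ) ≠ 0 := by
    norm_cast
    positivity
  have hx := ofReal_sub_neg_I_ne_zero x
  rw [h1, Complex.exp_mul_I, ← Complex.ofReal_cos, ← Complex.ofReal_sin, Real.cos_arctan,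
    Real.sin_arctan, cayley]
  push_cast
  have h2 := one_add_sq_eq x
  have hx' : (x : ℂ) - I ≠ 0 := ofReal_sub_ne_zero x (by simp)
  have h3 : (1 / ((√(1 + x ^ 2) : ℝ) : ℂ) + x / ((√(1 + x ^ 2) : ℝ) : ℂ) * I) ^ 2
      = (1 + x * I) ^ 2 / (1 + (x : ℂ) ^ 2) := by
    rw [← hs]
    field_simp
  rw [h3, h2]
  field_simp
  ring_nf
  simp only [I_sq]
  ring

lemma neg_inv_cayley_mul (x : ℝ) :
    -(cayley x)⁻¹ * (1 + (x : ℂ) ^ 2) = ((x : ℂ) - (-I)) ^ 2 := by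
  have hx := ofReal_sub_neg_I_ne_zero x
  have hx' : (x : ℂ) - I ≠ 0 := ofReal_sub_ne_zero x (by simp)
  have hcx : cayley x = -((x : ℂ) - I) / ((x : ℂ) - (-I)) := by
    rw [cayley]
    field_simp
    ring
  rw [hcx, one_add_sq_eq]
  field_simp

lemma norm_cayley (x : ℝ) : ‖cayley x‖ = 1 := by
  rw [cayley_eq_exp, mul_comm, Complex.norm_exp_ofReal_mul_I]

lemma cayley_ne_zero (x : ℝ) : cayley x ≠ 0 := by
  rw [← norm_ne_zero_iff, norm_cayley]
  exact one_ne_zero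

lemma measurable_cayley : Measurable cayley := by
  unfold cayley
  fun_prop

lemma fourier_two_arctan (n : ℤ) (x : ℝ) :
    fourier n ((2 * Real.arctan x : ℝ) : AddCircle (2 * π)) = cayley x ^ n := by
  rw [fourier_coe_apply, cayley_eq_exp, ← Complex.exp_int_mul]
  congr 1
  push_cast
  have : (π : ℂ) ≠ 0 := by exact_mod_cast Real.pi_ne_zero
  field_simp

section Fourier

lemma fact_two_pi_pos : Fact (0 < 2 * π) := ⟨Real.two_pi_pos⟩

attribute [local instance] fact_two_pi_pos

lemma fourierCoeff_lift_deriv {h h' : ℝ → ℂ} (hd : ∀ t, HasDerivAt h (h' t) t)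
    (hc : Continuous h') (hp : Function.Periodic h (2 * π)) (hp' : Function.Periodic h' (2 * π))
    (n : ℤ) : fourierCoeff hp'.lift n = I * n * fourierCoeff hp.lift n := by
  rw [fourierCoeff_eq_intervalIntegral _ n 0, fourierCoeff_eq_intervalIntegral _ n 0]
  simp only [Function.Periodic.lift_coe, smul_eq_mul, zero_add]
  have hF : ∀ t : ℝ, HasDerivAt (fun y : ℝ => fourier (-n) (y : AddCircle (2 * π)))
      (-I * n * fourier (-n) (t : AddCircle (2 * π))) t := fun t => by
    convert! hasDerivAt_fourier_neg (2 * π) n t using 2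
    have : (π : ℂ) ≠ 0 := by exact_mod_cast Real.pi_ne_zero
    push_cast
    field_simp
  have hFc : Continuous (fun y : ℝ => fourier (-n) (y : AddCircle (2 * π))) :=
    (map_continuous (fourier (-n))).comp (AddCircle.continuous_mk' _)
  have key := intervalIntegral.integral_mul_deriv_eq_deriv_mul (a := 0) (b := 2 * π)
    (fun t _ => hF t) (fun t _ => hd t)
    ((hFc.const_mul _).intervalIntegrable _ _) (hc.intervalIntegrable _ _)
  have hz : h (2 * π) = h 0 := by simpa using hp 0
  have hz' : fourier (-n) ((2 * π : ℝ) : AddCircle (2 * π)) =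
      fourier (-n) ((0 : ℝ) : AddCircle (2 * π)) := by
    congr 1
    simp
  rw [key, hz, hz', sub_self, zero_sub]
  simp only [mul_assoc]
  rw [intervalIntegral.integral_const_mul, intervalIntegral.integral_const_mul]
  simp only [Complex.real_smul]
  ring

lemma norm_fourierCoeff_le {h : AddCircle (2 * π) → ℂ} {C : ℝ} (hC : ∀ t, ‖h t‖ ≤ C) (n : ℤ) :
    ‖fourierCoeff h n‖ ≤ C := by
  unfold fourierCoeff
  refine (norm_integral_le_of_norm_le_const (C := C) (ae_of_all _ fun t => ?_)).trans ?_
  · rw [norm_smul, fourier_apply, Circle.norm_coe, one_mul]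
    exact hC t
  · simp

/-- A smooth `2π`-periodic function has an absolutely convergent Fourier series which may be
differentiated term by term. -/
lemma exists_fourier_series_of_periodic {h : ℝ → ℂ} (hh : ContDiff ℝ (⊤ : ℕ∞) h)
    (hp : Function.Periodic h (2 * π)) :
    ∃ c : ℤ → ℂ, Summable (fun n : ℤ => ‖c n‖) ∧ Summable (fun n : ℤ => |(n : ℝ)| * ‖c n‖) ∧
      (∀ t : ℝ, HasSum (fun n : ℤ => c n * fourier n (t : AddCircle (2 * π))) (h t)) ∧
      ∀ t : ℝ, HasSum (fun n : ℤ => I * n * c n * fourier n (t : AddCircle (2 * π)))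
        (deriv h t) := by
  have hper : ∀ {g : ℝ → ℂ}, Function.Periodic g (2 * π) → Function.Periodic (deriv g) (2 * π) := by
    intro g hg t
    rw [← deriv_comp_add_const]
    congr 1
    exact funext hg
  have hsm : ∀ {g : ℝ → ℂ}, ContDiff ℝ (⊤ : ℕ∞) g → ContDiff ℝ (⊤ : ℕ∞) (deriv g) := fun hg =>
    (contDiff_infty_iff_deriv.1 hg).2
  have hda : ∀ {g : ℝ → ℂ}, ContDiff ℝ (⊤ : ℕ∞) g → ∀ t, HasDerivAt g (deriv g t) t := fun hg t =>
    ((hg.differentiable (by simp)) t).hasDerivAt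
  have hcf : ∀ {g : ℝ → ℂ} (hg : ContDiff ℝ (⊤ : ℕ∞) g) (hgp : Function.Periodic g (2 * π)) (n : ℤ),
      fourierCoeff (hper hgp).lift n = I * n * fourierCoeff hgp.lift n := fun hg hgp n =>
    fourierCoeff_lift_deriv (hda hg) (hsm hg).continuous hgp (hper hgp) n
  have hbd : ∀ {g : ℝ → ℂ} (hg : ContDiff ℝ (⊤ : ℕ∞) g) (hgp : Function.Periodic g (2 * π)),
      ∃ C, ∀ n : ℤ, ‖fourierCoeff hgp.lift n‖ ≤ C := by
    intro g hg hgp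
    have hcont : Continuous (hgp.lift : AddCircle (2 * π) → ℂ) :=
      continuous_coinduced_dom.mpr hg.continuous
    obtain ⟨C, hC⟩ := isCompact_univ.exists_bound_of_continuousOn hcont.continuousOn
    exact ⟨C, norm_fourierCoeff_le fun t => hC t (mem_univ t)⟩
  set c : ℤ → ℂ := fourierCoeff hp.lift with hc
  obtain ⟨C₀, hC₀⟩ := hbd hh hp
  obtain ⟨C, hC⟩ := hbd (hsm (hsm (hsm hh))) (hper (hper (hper hp)))
  have hdecay : ∀ n : ℤ, |(n : ℝ)| ^ 3 * ‖c n‖ ≤ C := by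
    intro n
    have := hC n
    rw [hcf (hsm (hsm hh)) (hper (hper hp)), hcf (hsm hh) (hper hp), hcf hh hp] at this
    simp only [norm_mul, Complex.norm_I, one_mul, Complex.norm_intCast] at this
    calc _ = |(n : ℝ)| * (|(n : ℝ)| * (|(n : ℝ)| * ‖c n‖)) := by ring
      _ ≤ C := this
  have hsum2 : Summable (fun n : ℤ => |(n : ℝ)| * ‖c n‖) := by
    have hs : Summable (fun n : ℤ => C * (1 / (n : ℝ) ^ 2)) :=
      (Real.summable_one_div_int_pow.2 (by norm_num)).mul_left C
    refine Summable.of_nonneg_of_le (fun n => by positivity) (fun n => ?_) hs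
    rcases eq_or_ne n 0 with rfl | hn
    · simp
    · have hn' : 0 < |(n : ℝ)| := by positivity
      rw [← sq_abs, mul_one_div, le_div_iff₀ (by positivity)]
      calc _ = |(n : ℝ)| ^ 3 * ‖c n‖ := by ring
        _ ≤ C := hdecay n
  have hsum1 : Summable (fun n : ℤ => ‖c n‖) := by
    refine Summable.of_norm_bounded_eventually hsum2 ?_
    filter_upwards [(Set.finite_singleton (0 : ℤ)).compl_mem_cofinite] with n hn
    have h1 : (1 : ℝ) ≤ |(n : ℝ)| := by
      exact_mod_cast Int.one_le_abs hn
    rw [norm_norm]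
    nlinarith [norm_nonneg (c n)]
  refine ⟨c, hsum1, hsum2, fun t => ?_, fun t => ?_⟩
  · have := has_pointwise_sum_fourier_series_of_summable
      (f := ⟨hp.lift, continuous_coinduced_dom.mpr hh.continuous⟩) hsum1.of_norm t
    simpa [-fourier_apply] using this
  · have hs : Summable (fourierCoeff (hper hp).lift) := by
      apply Summable.of_norm
      refine hsum2.congr fun n => ?_
      rw [hcf hh hp]
      simp [hc]
    have := has_pointwise_sum_fourier_series_of_summable
      (f := ⟨(hper hp).lift, continuous_coinduced_dom.mpr (hsm hh).continuous⟩) hs t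
    simp only [ContinuousMap.coe_mk, Function.Periodic.lift_coe, smul_eq_mul, hcf hh hp] at this
    exact this

/-- A test function on the line, transported to the circle by the Cayley transform. -/
lemma contDiff_comp_tan_half {ψ : ℝ → ℝ} (hψ : ContDiff ℝ (⊤ : ℕ∞) ψ) (hc : HasCompactSupport ψ) :
    ContDiff ℝ (⊤ : ℕ∞)
      (fun t : ℝ => if Real.cos (t / 2) = 0 then (0 : ℂ) else (ψ (Real.tan (t / 2)) : ℂ)) := by
  rw [contDiff_iff_contDiffAt]
  intro t
  by_cases ht : Real.cos (t / 2) = 0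
  · obtain ⟨M, hM⟩ := hc.isCompact.isBounded.exists_norm_le
    have hz : ∀ x, M < |x| → ψ x = 0 := fun x hx => by
      by_contra hne
      exact absurd (hM x (subset_tsupport ψ hne)) (not_le.2 hx)
    have hev : ∀ᶠ s in 𝓝 t, (M + 1) * |Real.cos (s / 2)| < |Real.sin (s / 2)| := by
      have h1 : Continuous fun s : ℝ => (M + 1) * |Real.cos (s / 2)| := by fun_prop
      have h2 : Continuous fun s : ℝ => |Real.sin (s / 2)| := by fun_prop
      refine h1.continuousAt.eventually_lt h2.continuousAt ?_
      have := Real.sin_sq_add_cos_sq (t / 2)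
      rw [ht] at this ⊢
      simp only [abs_zero, mul_zero, abs_pos]
      intro h0
      simp [h0] at this
    refine (contDiffAt_const (c := (0 : ℂ))).congr_of_eventuallyEq ?_
    filter_upwards [hev] with s hs
    split_ifs with h0
    · rfl
    · rw [hz, Complex.ofReal_zero]
      rw [Real.tan_eq_sin_div_cos, abs_div, lt_div_iff₀ (abs_pos.2 h0)]
      nlinarith [abs_nonneg (Real.cos (s / 2))]
  · have hev : ∀ᶠ s in 𝓝 t, Real.cos (s / 2) ≠ 0 := by
      have h1 : Continuous fun s : ℝ => Real.cos (s / 2) := by fun_prop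
      exact h1.continuousAt.eventually_ne ht
    have hsm : ContDiffAt ℝ (⊤ : ℕ∞) (fun s : ℝ => (ψ (Real.tan (s / 2)) : ℂ)) t := by
      refine Complex.ofRealCLM.contDiff.contDiffAt.comp t (hψ.contDiffAt.comp t ?_)
      have h1 : ContDiffAt ℝ (⊤ : ℕ∞) Real.tan (t / 2) := Real.contDiffAt_tan.2 ht
      have h2 : ContDiffAt ℝ (⊤ : ℕ∞) (fun s : ℝ => s / 2) t := contDiffAt_id.div_const 2
      exact ContDiffAt.comp (g := Real.tan) (f := fun s : ℝ => s / 2) t h1 h2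
    refine hsm.congr_of_eventuallyEq ?_
    filter_upwards [hev] with s hs
    simp [hs]

/-- A test function is an absolutely convergent series of powers of the Cayley transform, which
may be differentiated term by term. -/
lemma exists_cayley_series {ψ : ℝ → ℝ} (hψ : ContDiff ℝ (⊤ : ℕ∞) ψ) (hc : HasCompactSupport ψ) :
    ∃ c : ℤ → ℂ, Summable (fun n : ℤ => ‖c n‖) ∧ Summable (fun n : ℤ => |(n : ℝ)| * ‖c n‖) ∧
      (∀ x : ℝ, HasSum (fun n : ℤ => c n * cayley x ^ n) (ψ x : ℂ)) ∧
      ∀ x : ℝ, HasSum (fun n : ℤ => c n * (-2 * I * n) * cayley x ^ (n - 1))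
        (((deriv ψ x : ℝ) : ℂ) * ((x : ℂ) - (-I)) ^ 2) := by
  set h : ℝ → ℂ :=
    fun t : ℝ => if Real.cos (t / 2) = 0 then (0 : ℂ) else (ψ (Real.tan (t / 2)) : ℂ) with hdef
  have hp : Function.Periodic h (2 * π) := fun t => by
    have h1 : (t + 2 * π) / 2 = t / 2 + π := by ring
    simp only [hdef, h1, Real.cos_add_pi, Real.tan_add_pi, neg_eq_zero]
  obtain ⟨c, hc1, hc2, hs, hs'⟩ := exists_fourier_series_of_periodic
    (contDiff_comp_tan_half hψ hc) hp
  have hcos : ∀ x : ℝ, Real.cos (Real.arctan x) ≠ 0 := fun x => (Real.cos_arctan_pos x).ne'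
  have harg : ∀ x : ℝ, 2 * Real.arctan x / 2 = Real.arctan x := fun x => by ring
  refine ⟨c, hc1, hc2, fun x => ?_, fun x => ?_⟩
  · have := hs (2 * Real.arctan x)
    simp only [fourier_two_arctan, harg, hcos, if_false, Real.tan_arctan] at this
    exact this
  · have h1 := hs' (2 * Real.arctan x)
    simp only [fourier_two_arctan] at h1
    have hder : HasDerivAt h ((deriv ψ x * ((1 + x ^ 2) / 2) : ℝ) : ℂ) (2 * Real.arctan x) := by
      have ht : HasDerivAt (fun s : ℝ => Real.tan (s / 2)) ((1 + x ^ 2) / 2)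
          (2 * Real.arctan x) := by
        have h2 := (Real.hasDerivAt_tan (x := 2 * Real.arctan x / 2) (by rw [harg]; exact hcos x))
        have h2' : HasDerivAt (fun s : ℝ => s / 2) (1 / 2) (2 * Real.arctan x) :=
          (hasDerivAt_id _).div_const 2
        have h3 := HasDerivAt.comp (h₂ := Real.tan) (h := fun s : ℝ => s / 2) _ h2 h2'
        convert! h3 using 1
        rw [harg, Real.cos_sq_arctan]
        field_simp
      have hψd : HasDerivAt ψ (deriv ψ x) (Real.tan (2 * Real.arctan x / 2)) := by
        rw [harg, Real.tan_arctan]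
        exact (hψ.differentiable (by simp) x).hasDerivAt
      have h4 := (hψd.comp (2 * Real.arctan x) ht).ofReal_comp
      refine h4.congr_of_eventuallyEq ?_
      have hcont : Continuous fun s : ℝ => Real.cos (s / 2) := by fun_prop
      filter_upwards [hcont.continuousAt.eventually_ne (x := 2 * Real.arctan x)
        (by rw [harg]; exact hcos x)] with s hs
      simp [hdef, hs]
    rw [hder.deriv] at h1
    have h5 := h1.mul_left (-2 * (cayley x)⁻¹)
    convert! h5 using 1
    · funext n
      rw [zpow_sub_one₀ (cayley_ne_zero x)]
      ring
    · rw [Complex.ofReal_mul, Complex.ofReal_div, Complex.ofReal_add, Complex.ofReal_pow,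
        Complex.ofReal_one, Complex.ofReal_ofNat, ← neg_inv_cayley_mul]
      ring

end Fourier

/-- `C` bounds all the finite sums whose supremum is the trace norm of `T`. -/
def TraceBound (T : 𝓗 →L[ℂ] 𝓗) (C : ℝ) : Prop :=
  ∀ (n : ℕ) (e f : Fin n → 𝓗), Orthonormal ℂ e → Orthonormal ℂ f →
    ∑ i, ‖⟪e i, T (f i)⟫_ℂ‖ ≤ C

namespace TraceBound

variable {T S : 𝓗 →L[ℂ] 𝓗} {C D : ℝ}

lemma isTraceClass (h : TraceBound T C) : IsTraceClass T := ⟨C, h⟩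

lemma nonneg (h : TraceBound T C) : 0 ≤ C := by
  simpa using h 0 Fin.elim0 Fin.elim0 (by simp [Orthonormal]) (by simp [Orthonormal])

lemma mono (h : TraceBound T C) (hCD : C ≤ D) : TraceBound T D :=
  fun n e f he hf => (h n e f he hf).trans hCD

lemma zero : TraceBound (0 : 𝓗 →L[ℂ] 𝓗) 0 := fun n e f _ _ => by simp

lemma add (hT : TraceBound T C) (hS : TraceBound S D) : TraceBound (T + S) (C + D) := by
  intro n e f he hf
  refine le_trans ?_ (add_le_add (hT n e f he hf) (hS n e f he hf))
  rw [← Finset.sum_add_distrib]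
  refine Finset.sum_le_sum fun i _ => ?_
  rw [add_apply, inner_add_right]
  exact norm_add_le _ _

lemma smul (hT : TraceBound T C) (a : ℂ) : TraceBound (a • T) (‖a‖ * C) := by
  intro n e f he hf
  refine le_trans (le_of_eq ?_) (mul_le_mul_of_nonneg_left (hT n e f he hf) (norm_nonneg a))
  rw [Finset.mul_sum]
  refine Finset.sum_congr rfl fun i _ => ?_
  rw [smul_apply, inner_smul_right, norm_mul]

lemma sum {ι : Type*} (s : Finset ι) {T : ι → 𝓗 →L[ℂ] 𝓗} {C : ι → ℝ}
    (h : ∀ i ∈ s, TraceBound (T i) (C i)) : TraceBound (∑ i ∈ s, T i) (∑ i ∈ s, C i) := by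
  classical
  induction s using Finset.induction_on with
  | empty => simpa using zero
  | insert a s ha ih =>
    rw [Finset.sum_insert ha, Finset.sum_insert ha]
    exact (h a (Finset.mem_insert_self a s)).add
      (ih fun i hi => h i (Finset.mem_insert_of_mem hi))

lemma star (hT : TraceBound T C) : TraceBound (star T) C := by
  intro n e f he hf
  refine le_trans (le_of_eq ?_) (hT n f e hf he)
  refine Finset.sum_congr rfl fun i _ => ?_
  rw [ContinuousLinearMap.star_eq_adjoint, ContinuousLinearMap.adjoint_inner_right,
    ← inner_conj_symm, RCLike.norm_conj]

lemma unitary_mul (hT : TraceBound T C) {U : 𝓗 →L[ℂ] 𝓗} (hU : U ∈ unitary (𝓗 →L[ℂ] 𝓗)) :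
    TraceBound (U * T) C := by
  intro n e f he hf
  have he' : Orthonormal ℂ fun i => Star.star U (e i) := by
    rw [orthonormal_iff_ite] at he ⊢
    intro i j
    rw [ContinuousLinearMap.inner_map_map_of_mem_unitary (Unitary.star_mem hU)]
    exact he i j
  refine le_trans (le_of_eq ?_) (hT n _ f he' hf)
  refine Finset.sum_congr rfl fun i _ => ?_
  rw [ContinuousLinearMap.star_eq_adjoint, ContinuousLinearMap.adjoint_inner_left]
  rfl

lemma mul_left (hT : TraceBound T C) (A : 𝓗 →L[ℂ] 𝓗) : TraceBound (A * T) (2 * ‖A‖ * C) := by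
  obtain ⟨u, c, hA, hc⟩ := CStarAlgebra.exists_sum_four_unitary A
  have h : TraceBound (∑ i, c i • ((u i : 𝓗 →L[ℂ] 𝓗) * T)) (∑ i, ‖c i‖ * C) :=
    sum _ fun i _ => (hT.unitary_mul (u i).2).smul (c i)
  have hAT : A * T = ∑ i, c i • ((u i : 𝓗 →L[ℂ] 𝓗) * T) := by
    conv_lhs => rw [hA]
    simp only [Finset.sum_mul, smul_mul_assoc]
  rw [hAT]
  refine h.mono ?_
  rw [Fin.sum_univ_four]
  nlinarith [hc 0, hc 1, hc 2, hc 3, hT.nonneg]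

lemma mul_right (hT : TraceBound T C) (A : 𝓗 →L[ℂ] 𝓗) : TraceBound (T * A) (2 * ‖A‖ * C) := by
  have := (hT.star.mul_left (Star.star A)).star
  rwa [star_mul, star_star, star_star, norm_star] at this

lemma of_hasSum {ι : Type*} {T : ι → 𝓗 →L[ℂ] 𝓗} {S : 𝓗 →L[ℂ] 𝓗} {C : ι → ℝ}
    (h : ∀ i, TraceBound (T i) (C i)) (hC : Summable C) (hS : HasSum T S) :
    TraceBound S (∑' i, C i) := by
  intro n e f he hf
  have h1 : Tendsto (fun s : Finset ι => ∑ i, ‖⟪e i, (∑ k ∈ s, T k) (f i)⟫_ℂ‖) atTop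
      (𝓝 (∑ i, ‖⟪e i, S (f i)⟫_ℂ‖)) := by
    have hS' : Tendsto (fun s : Finset ι => ∑ k ∈ s, T k) atTop (𝓝 S) := hS
    refine tendsto_finsetSum _ fun i _ => Tendsto.norm ?_
    have hc : Continuous fun A : 𝓗 →L[ℂ] 𝓗 => ⟪e i, A (f i)⟫_ℂ := by fun_prop
    exact (hc.tendsto S).comp hS'
  refine le_of_tendsto' h1 fun s => ?_
  exact (sum s (fun i _ => h i) n e f he hf).trans (hC.sum_le_tsum s fun i _ => (h i).nonneg)

end TraceBound

namespace IsTraceClass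

variable {T S : 𝓗 →L[ℂ] 𝓗}

lemma add (hT : IsTraceClass T) (hS : IsTraceClass S) : IsTraceClass (T + S) := by
  obtain ⟨C, hC⟩ := hT
  obtain ⟨D, hD⟩ := hS
  exact ⟨_, TraceBound.add hC hD⟩

lemma smul (hT : IsTraceClass T) (a : ℂ) : IsTraceClass (a • T) := by
  obtain ⟨C, hC⟩ := hT
  exact ⟨_, TraceBound.smul hC a⟩

lemma neg (hT : IsTraceClass T) : IsTraceClass (-T) := by
  simpa using hT.smul (-1)

lemma star (hT : IsTraceClass T) : IsTraceClass (star T) := by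
  obtain ⟨C, hC⟩ := hT
  exact ⟨_, TraceBound.star hC⟩

lemma mul_left (hT : IsTraceClass T) (A : 𝓗 →L[ℂ] 𝓗) : IsTraceClass (A * T) := by
  obtain ⟨C, hC⟩ := hT
  exact ⟨_, TraceBound.mul_left hC A⟩

lemma mul_right (hT : IsTraceClass T) (A : 𝓗 →L[ℂ] 𝓗) : IsTraceClass (T * A) := by
  obtain ⟨C, hC⟩ := hT
  exact ⟨_, TraceBound.mul_right hC A⟩

end IsTraceClass

variable (𝓗) in
/-- The index set of the Hilbert basis in which traces are computed. -/
abbrev TraceIndex : Set 𝓗 := (exists_hilbertBasis ℂ 𝓗).choose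

variable (𝓗) in
/-- The Hilbert basis in which traces are computed. -/
def traceBasis : HilbertBasis (TraceIndex 𝓗) ℂ 𝓗 := (exists_hilbertBasis ℂ 𝓗).choose_spec.choose

lemma traceBasis_apply (i : TraceIndex 𝓗) : traceBasis 𝓗 i = i :=
  congrFun (exists_hilbertBasis ℂ 𝓗).choose_spec.choose_spec i

lemma trace_eq_tsum (T : 𝓗 →L[ℂ] 𝓗) :
    trace T = ∑' i, ⟪traceBasis 𝓗 i, T (traceBasis 𝓗 i)⟫_ℂ := by
  simp only [traceBasis_apply]
  rfl

lemma TraceBound.sum_basis_le {T : 𝓗 →L[ℂ] 𝓗} {C : ℝ} (h : TraceBound T C)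
    (s : Finset (TraceIndex 𝓗)) :
    ∑ i ∈ s, ‖⟪traceBasis 𝓗 i, T (traceBasis 𝓗 i)⟫_ℂ‖ ≤ C := by
  have ho : Orthonormal ℂ fun k : Fin s.card => traceBasis 𝓗 (s.equivFin.symm k) :=
    (traceBasis 𝓗).orthonormal.comp (fun k => (s.equivFin.symm k : TraceIndex 𝓗))
      (Subtype.val_injective.comp s.equivFin.symm.injective)
  refine le_trans (le_of_eq ?_) (h s.card _ _ ho ho)
  rw [← Finset.sum_coe_sort s]
  exact (Equiv.sum_comp s.equivFin.symm
    (fun k : s => ‖⟪traceBasis 𝓗 k, T (traceBasis 𝓗 k)⟫_ℂ‖)).symm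

lemma TraceBound.summable_norm {T : 𝓗 →L[ℂ] 𝓗} {C : ℝ} (h : TraceBound T C) :
    Summable fun i => ‖⟪traceBasis 𝓗 i, T (traceBasis 𝓗 i)⟫_ℂ‖ :=
  summable_of_sum_le (fun _ => norm_nonneg _) h.sum_basis_le

lemma TraceBound.norm_trace_le {T : 𝓗 →L[ℂ] 𝓗} {C : ℝ} (h : TraceBound T C) : ‖trace T‖ ≤ C := by
  rw [trace_eq_tsum]
  exact (norm_tsum_le_tsum_norm h.summable_norm).trans
    (h.summable_norm.tsum_le_of_sum_le h.sum_basis_le)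

lemma IsTraceClass.summable {T : 𝓗 →L[ℂ] 𝓗} (h : IsTraceClass T) :
    Summable fun i => ⟪traceBasis 𝓗 i, T (traceBasis 𝓗 i)⟫_ℂ := by
  obtain ⟨C, hC⟩ := h
  exact (TraceBound.summable_norm hC).of_norm

lemma trace_add {T S : 𝓗 →L[ℂ] 𝓗} (hT : IsTraceClass T) (hS : IsTraceClass S) :
    trace (T + S) = trace T + trace S := by
  simp only [trace_eq_tsum, add_apply, inner_add_right]
  exact hT.summable.tsum_add hS.summable

lemma trace_smul (a : ℂ) (T : 𝓗 →L[ℂ] 𝓗) : trace (a • T) = a * trace T := by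
  simp only [trace_eq_tsum, smul_apply, inner_smul_right]
  exact tsum_mul_left

lemma trace_sum {ι : Type*} (s : Finset ι) {T : ι → 𝓗 →L[ℂ] 𝓗}
    (h : ∀ i ∈ s, IsTraceClass (T i)) : trace (∑ i ∈ s, T i) = ∑ i ∈ s, trace (T i) := by
  simp only [trace_eq_tsum, sum_apply, inner_sum]
  exact Summable.tsum_finsetSum fun i hi => (h i hi).summable

lemma hasSum_trace {ι : Type*} {T : ι → 𝓗 →L[ℂ] 𝓗} {S : 𝓗 →L[ℂ] 𝓗} {C : ι → ℝ}
    (h : ∀ i, TraceBound (T i) (C i)) (hC : Summable C) (hS : HasSum T S) :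
    HasSum (fun i => trace (T i)) (trace S) := by
  classical
  have hr : ∀ s : Finset ι, TraceBound (S - ∑ i ∈ s, T i) (∑' i : {i // i ∉ s}, C i) := by
    intro s
    have h1 : HasSum (fun i : {i // i ∉ s} => T i) (S - ∑ i ∈ s, T i) := by
      rw [Finset.hasSum_compl_iff s]
      simpa using hS
    exact TraceBound.of_hasSum (fun i : {i // i ∉ s} => h i) (hC.subtype _) h1
  rw [HasSum, SummationFilter.unconditional_filter, tendsto_iff_norm_sub_tendsto_zero]
  refine squeeze_zero (fun _ => norm_nonneg _) (fun s => ?_) (tendsto_tsum_compl_atTop_zero C)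
  have hs : IsTraceClass (∑ i ∈ s, T i) := ⟨_, TraceBound.sum s fun i _ => h i⟩
  have h2 : trace S - ∑ i ∈ s, trace (T i) = trace (S - ∑ i ∈ s, T i) := by
    rw [← trace_sum s fun i _ => (h i).isTraceClass, sub_eq_iff_eq_add,
      ← trace_add (hr s).isTraceClass hs, sub_add_cancel]
  rw [norm_sub_rev, h2]
  exact (hr s).norm_trace_le

open ContinuousLinearMap in
lemma TraceBound.of_dist_le {T : 𝓗 →L[ℂ] 𝓗} {C : ℝ}
    (h : ∀ ε > 0, ∃ S, TraceBound S C ∧ ‖T - S‖ ≤ ε) : TraceBound T C := by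
  intro n e f he hf
  refine le_of_forall_pos_le_add fun δ hδ => ?_
  obtain ⟨S, hS, hTS⟩ := h (δ / (n + 1)) (by positivity)
  have h1 : ∑ i, ‖⟪e i, T (f i)⟫_ℂ‖ ≤ ∑ i, (‖⟪e i, S (f i)⟫_ℂ‖ + δ / (n + 1)) := by
    refine Finset.sum_le_sum fun i _ => ?_
    have h2 : ⟪e i, T (f i)⟫_ℂ = ⟪e i, S (f i)⟫_ℂ + ⟪e i, (T - S) (f i)⟫_ℂ := by
      rw [← inner_add_right]; simp
    rw [h2]
    refine (norm_add_le _ _).trans (add_le_add le_rfl ?_)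
    calc ‖⟪e i, (T - S) (f i)⟫_ℂ‖ ≤ ‖e i‖ * ‖(T - S) (f i)‖ := norm_inner_le_norm _ _
      _ ≤ ‖e i‖ * (‖T - S‖ * ‖f i‖) := by gcongr; exact le_opNorm _ _
      _ = ‖T - S‖ := by rw [he.1, hf.1]; ring
      _ ≤ _ := hTS
  refine h1.trans ?_
  rw [Finset.sum_add_distrib]
  refine add_le_add (hS n e f he hf) ?_
  simp only [Finset.sum_const, Finset.card_univ, Fintype.card_fin, nsmul_eq_mul]
  rw [mul_div_assoc', div_le_iff₀ (by positivity)]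
  nlinarith

lemma traceBound_posPart {T : 𝓗 →L[ℂ] 𝓗} (hT : IsSelfAdjoint T) {C : ℝ} (h : TraceBound T C) :
    TraceBound (cfc (fun x : ℝ => max x 0) T) (2 * C) := by
  refine TraceBound.of_dist_le fun ε hε => ?_
  refine ⟨T * cfc (fun x : ℝ => min 1 (max (x / ε) 0)) T, ?_, ?_⟩
  · refine (h.mul_right _).mono ?_
    have : ‖cfc (fun x : ℝ => min 1 (max (x / ε) 0)) T‖ ≤ 1 := by
      refine norm_cfc_le (by norm_num) fun x _ => ?_
      rw [Real.norm_of_nonneg (by positivity)]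
      exact min_le_left _ _
    have := h.nonneg
    nlinarith
  · have h1 : T * cfc (fun x : ℝ => min 1 (max (x / ε) 0)) T
        = cfc (fun x : ℝ => x * min 1 (max (x / ε) 0)) T := by
      rw [cfc_mul (fun x : ℝ => x) (fun x : ℝ => min 1 (max (x / ε) 0)) T (by fun_prop)
        (by fun_prop), cfc_id' ℝ T]
    rw [h1, ← cfc_sub (fun x : ℝ => max x 0) _ T (by fun_prop) (by fun_prop)]
    refine norm_cfc_le hε.le fun x _ => ?_
    rw [Real.norm_eq_abs, abs_le]
    rcases le_total x 0 with hx | hx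
    · have : x / ε ≤ 0 := div_nonpos_of_nonpos_of_nonneg hx hε.le
      rw [max_eq_right hx, max_eq_right this]; simp [hε.le]
    · have h0 : 0 ≤ x / ε := by positivity
      rw [max_eq_left hx, max_eq_left h0]
      rcases le_total (x / ε) 1 with h2 | h2
      · rw [min_eq_right h2]
        have h3 : x ≤ ε := by rwa [div_le_one hε] at h2
        constructor <;> nlinarith
      · rw [min_eq_left h2]; simp [hε.le]

lemma IsTraceClass.exists_sq {T : 𝓗 →L[ℂ] 𝓗} (hT : IsSelfAdjoint T) (h : IsTraceClass T) :
    ∃ Q : 𝓗 →L[ℂ] 𝓗, IsSelfAdjoint Q ∧ Q * Q = cfc (fun x : ℝ => max x 0) T ∧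
      IsTraceClass (Q * Q) := by
  obtain ⟨C, hC⟩ := h
  have hQ : cfc (fun x : ℝ => √(max x 0)) T * cfc (fun x : ℝ => √(max x 0)) T
      = cfc (fun x : ℝ => max x 0) T := by
    rw [← cfc_mul _ _ T (by fun_prop) (by fun_prop)]
    refine cfc_congr fun x _ => ?_
    exact Real.mul_self_sqrt (le_max_right _ _)
  exact ⟨_, cfc_predicate _ _, hQ, hQ ▸ ⟨_, traceBound_posPart hT hC⟩⟩

/-- Trace class operators are spanned by squares of self-adjoint operators. -/
lemma IsTraceClass.induction {p : (𝓗 →L[ℂ] 𝓗) → Prop}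
    (hadd : ∀ S T, IsTraceClass S → IsTraceClass T → p S → p T → p (S + T))
    (hsmul : ∀ (c : ℂ) T, IsTraceClass T → p T → p (c • T))
    (hsq : ∀ Q, IsSelfAdjoint Q → IsTraceClass (Q * Q) → p (Q * Q))
    {T : 𝓗 →L[ℂ] 𝓗} (hT : IsTraceClass T) : p T := by
  have hsa : ∀ S : 𝓗 →L[ℂ] 𝓗, IsSelfAdjoint S → IsTraceClass S → p S := by
    intro S hS hSt
    obtain ⟨Q, hQ, hQS, hQt⟩ := hSt.exists_sq hS
    obtain ⟨Q', hQ', hQS', hQt'⟩ := hSt.neg.exists_sq hS.neg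
    have h1 : S = Q * Q + (-1 : ℂ) • (Q' * Q') := by
      have h2 : Q' * Q' = cfc (fun x : ℝ => max (-x) 0) S := by
        rw [hQS', ← cfc_comp_neg (fun x : ℝ => max x 0) S (by fun_prop)]
      rw [h2, hQS, neg_one_smul, ← sub_eq_add_neg, ← cfc_sub _ _ S (by fun_prop) (by fun_prop)]
      conv_lhs => rw [← cfc_id' ℝ S]
      refine cfc_congr fun x _ => ?_
      rcases le_total x 0 with hx | hx
      · simp [hx]
      · simp [hx]
    rw [h1]
    exact hadd _ _ hQt (hQt'.smul _) (hsq _ hQ hQt) (hsmul _ _ hQt' (hsq _ hQ' hQt'))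
  have h1 : T = (1 / 2 : ℂ) • (T + Star.star T) + (-I / 2) • (I • T + (-I) • Star.star T) := by
    rw [smul_add, smul_add, smul_smul, smul_smul]
    have e1 : -I / 2 * I = 1 / 2 := by linear_combination (-1 / 2 : ℂ) * I_mul_I
    have e2 : -I / 2 * -I = -(1 / 2) := by linear_combination (1 / 2 : ℂ) * I_mul_I
    rw [e1, e2]
    module
  rw [h1]
  have t1 := hT.add hT.star
  have t2 := (hT.smul I).add (hT.star.smul (-I))
  refine hadd _ _ (t1.smul _) (t2.smul _) (hsmul _ _ t1 (hsa _ ?_ t1)) (hsmul _ _ t2 (hsa _ ?_ t2))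
  · rw [isSelfAdjoint_iff]; simp [add_comm]
  · rw [isSelfAdjoint_iff]; simp [add_comm]

section SqSummable

variable {ι : Type*} {b : HilbertBasis ι ℂ 𝓗}

/-- Square summability of the columns of an operator in the reference basis. -/
def SqSummable (b : HilbertBasis ι ℂ 𝓗) (X : 𝓗 →L[ℂ] 𝓗) : Prop := Summable fun i => ‖X (b i)‖ ^ 2

lemma norm_sq_hasSum (b : HilbertBasis ι ℂ 𝓗) (x : 𝓗) : HasSum (fun i => ‖⟪b i, x⟫_ℂ‖ ^ 2) (‖x‖ ^ 2) := by
  have h := (b).hasSum_inner_mul_inner x x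
  have h2 := (Complex.hasSum_iff _ _).1 h |>.1
  convert h2 using 1
  · ext i
    rw [← inner_conj_symm x, ← Complex.normSq_eq_conj_mul_self, Complex.ofReal_re,
      Complex.normSq_eq_norm_sq]
  · rw [inner_self_eq_norm_sq_to_K]
    norm_cast

lemma SqSummable.summable_prod {X : 𝓗 →L[ℂ] 𝓗} (h : SqSummable b X) :
    Summable fun p : ι × ι =>
      ‖⟪b p.2, X (b p.1)⟫_ℂ‖ ^ 2 := by
  have h0 : 0 ≤ fun p : ι × ι =>
      ‖⟪b p.2, X (b p.1)⟫_ℂ‖ ^ 2 := fun p => sq_nonneg _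
  refine (summable_prod_of_nonneg h0).2 ⟨fun i => (norm_sq_hasSum b (X (b i))).summable, ?_⟩
  exact h.congr fun i => (norm_sq_hasSum b (X (b i))).tsum_eq.symm

lemma SqSummable.star {X : 𝓗 →L[ℂ] 𝓗} (h : SqSummable b X) : SqSummable b (star X) := by
  have h1 : Summable fun p : ι × ι =>
      ‖⟪b p.1, X (b p.2)⟫_ℂ‖ ^ 2 := h.summable_prod.prod_symm
  have h0 : 0 ≤ fun p : ι × ι =>
      ‖⟪b p.1, X (b p.2)⟫_ℂ‖ ^ 2 := fun p => sq_nonneg _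
  have h2 := ((summable_prod_of_nonneg h0).1 h1).2
  refine h2.congr fun i => ?_
  rw [← (norm_sq_hasSum b (Star.star X (b i))).tsum_eq]
  refine tsum_congr fun j => ?_
  rw [ContinuousLinearMap.star_eq_adjoint, ContinuousLinearMap.adjoint_inner_right, norm_inner_symm]

lemma SqSummable.mul_left {X : 𝓗 →L[ℂ] 𝓗} (h : SqSummable b X) (A : 𝓗 →L[ℂ] 𝓗) :
    SqSummable b (A * X) := by
  refine Summable.of_nonneg_of_le (fun _ => by positivity) (fun i => ?_) (Summable.mul_left (‖A‖ ^ 2) h)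
  rw [← mul_pow]
  exact pow_le_pow_left₀ (norm_nonneg _) (A.le_opNorm _) 2

lemma SqSummable.mul_right {X : 𝓗 →L[ℂ] 𝓗} (h : SqSummable b X) (A : 𝓗 →L[ℂ] 𝓗) :
    SqSummable b (X * A) := by
  simpa using (h.star.mul_left (Star.star A)).star

lemma SqSummable.tsum_inner_mul_comm {X Y : 𝓗 →L[ℂ] 𝓗} (hX : SqSummable b X) (hY : SqSummable b Y) :
    ∑' i, ⟪b i, (X * Y) (b i)⟫_ℂ = ∑' i, ⟪b i, (Y * X) (b i)⟫_ℂ := by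
  have key : ∀ (X Y : 𝓗 →L[ℂ] 𝓗) (i : ι),
      ⟪b i, (X * Y) (b i)⟫_ℂ = ∑' j, ⟪b i, X (b j)⟫_ℂ *
        ⟪b j, Y (b i)⟫_ℂ := by
    intro X Y i
    rw [mul_apply_eq_comp, ← ContinuousLinearMap.adjoint_inner_left,
      ← (b).tsum_inner_mul_inner]
    simp only [ContinuousLinearMap.adjoint_inner_left]
  have hab : ∀ a b : ℝ, a * b ≤ a ^ 2 + b ^ 2 := fun a b => by
    nlinarith [sq_nonneg (a - b), sq_nonneg (a + b)]
  have hX' : Summable fun p : ι × ι => ‖⟪b p.1, X (b p.2)⟫_ℂ‖ ^ 2 := hX.summable_prod.prod_symm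
  have hs : Summable (Function.uncurry fun i j : ι => ⟪b i, X (b j)⟫_ℂ * ⟪b j, Y (b i)⟫_ℂ) := by
    refine Summable.of_norm_bounded (hX'.add hY.summable_prod) fun p => ?_
    simp only [Function.uncurry, norm_mul]
    exact hab _ _
  rw [tsum_congr (key X Y), tsum_congr (key Y X), ← hs.tsum_comm]
  exact tsum_congr fun i => tsum_congr fun j => mul_comm _ _

lemma SqSummable.trace_mul_comm {X Y : 𝓗 →L[ℂ] 𝓗} (hX : SqSummable (traceBasis 𝓗) X)
    (hY : SqSummable (traceBasis 𝓗) Y) : trace (X * Y) = trace (Y * X) := by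
  rw [trace_eq_tsum, trace_eq_tsum]
  exact hX.tsum_inner_mul_comm hY

lemma sqSummable_of_isTraceClass_sq {Q : 𝓗 →L[ℂ] 𝓗} (hQ : IsSelfAdjoint Q)
    (h : IsTraceClass (Q * Q)) : SqSummable (traceBasis 𝓗) Q := by
  have h1 := (Complex.hasSum_iff _ _).1 h.summable.hasSum |>.1.summable
  refine h1.congr fun i => ?_
  rw [mul_apply_eq_comp, ← ContinuousLinearMap.adjoint_inner_left,
    ← ContinuousLinearMap.star_eq_adjoint, hQ.star_eq, inner_self_eq_norm_sq_to_K]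
  norm_cast

lemma trace_mul_comm {T : 𝓗 →L[ℂ] 𝓗} (hT : IsTraceClass T) (A : 𝓗 →L[ℂ] 𝓗) :
    trace (A * T) = trace (T * A) := by
  refine hT.induction (p := fun T => trace (A * T) = trace (T * A)) ?_ ?_ ?_
  · intro S T hS hT h1 h2
    rw [mul_add, add_mul, trace_add (hS.mul_left _) (hT.mul_left _),
      trace_add (hS.mul_right _) (hT.mul_right _), h1, h2]
  · intro c T hT h
    rw [mul_smul_comm, smul_mul_assoc, trace_smul, trace_smul, h]
  · intro Q hQ h
    have hs := sqSummable_of_isTraceClass_sq hQ h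
    rw [← mul_assoc, (hs.mul_left A).trace_mul_comm hs, ← mul_assoc, (hs.mul_right A).trace_mul_comm hs,
      mul_assoc]

lemma tendsto_trace_mul {T : 𝓗 →L[ℂ] 𝓗} (hT : IsTraceClass T) {S : ℕ → 𝓗 →L[ℂ] 𝓗}
    {S' : 𝓗 →L[ℂ] 𝓗} {C : ℝ} (hC : ∀ n, ‖S n‖ ≤ C)
    (hS : ∀ x, Tendsto (fun n => ⟪x, S n x⟫_ℂ) atTop (𝓝 ⟪x, S' x⟫_ℂ)) :
    Tendsto (fun n => trace (T * S n)) atTop (𝓝 (trace (T * S'))) := by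
  refine hT.induction (p := fun T => Tendsto (fun n => trace (T * S n)) atTop
    (𝓝 (trace (T * S')))) ?_ ?_ ?_
  · intro S T hS hT h1 h2
    simp only [add_mul, trace_add (hS.mul_right _) (hT.mul_right _)]
    exact h1.add h2
  · intro c T hT h
    simp only [smul_mul_assoc, trace_smul]
    exact h.const_mul c
  · intro Q hQ h
    have hs := sqSummable_of_isTraceClass_sq hQ h
    have key : ∀ A : 𝓗 →L[ℂ] 𝓗, trace (Q * Q * A) =
        ∑' i, ⟪Q (traceBasis 𝓗 i), A (Q (traceBasis 𝓗 i))⟫_ℂ := by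
      intro A
      rw [mul_assoc, hs.trace_mul_comm (hs.mul_right A), mul_assoc, trace_eq_tsum]
      refine tsum_congr fun i => ?_
      rw [mul_apply_eq_comp, ← ContinuousLinearMap.adjoint_inner_left,
        ← ContinuousLinearMap.star_eq_adjoint, hQ.star_eq, mul_apply_eq_comp]
    simp only [key]
    refine tendsto_tsum_of_dominated_convergence (Summable.mul_left C hs) (fun i => hS _)
      (Eventually.of_forall fun n i => ?_)
    refine (norm_inner_le_norm _ _).trans ?_
    have := (S n).le_of_opNorm_le (hC n) (Q (traceBasis 𝓗 i))
    nlinarith [norm_nonneg (Q (traceBasis 𝓗 i))]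

end SqSummable

/-- Bounded measurable functions on the line. -/
def BddMeas (g : ℝ → ℂ) : Prop := Measurable g ∧ ∃ C, ∀ x, ‖g x‖ ≤ C

namespace BddMeas

variable {g h : ℝ → ℂ}

lemma bound (hg : BddMeas g) : ∃ C, 0 ≤ C ∧ ∀ x, ‖g x‖ ≤ C := by
  obtain ⟨C, hC⟩ := hg.2
  exact ⟨C, (norm_nonneg _).trans (hC 0), hC⟩

lemma const (c : ℂ) : BddMeas fun _ => c := ⟨measurable_const, ‖c‖, fun _ => le_rfl⟩

lemma add (hg : BddMeas g) (hh : BddMeas h) : BddMeas fun x => g x + h x := by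
  obtain ⟨C, hC⟩ := hg.2
  obtain ⟨D, hD⟩ := hh.2
  exact ⟨hg.1.add hh.1, C + D, fun x => (norm_add_le _ _).trans (add_le_add (hC x) (hD x))⟩

lemma mul (hg : BddMeas g) (hh : BddMeas h) : BddMeas fun x => g x * h x := by
  obtain ⟨C, hC0, hC⟩ := hg.bound
  obtain ⟨D, hD⟩ := hh.2
  refine ⟨hg.1.mul hh.1, C * D, fun x => ?_⟩
  rw [norm_mul]
  exact mul_le_mul (hC x) (hD x) (norm_nonneg _) hC0

lemma const_mul (hg : BddMeas g) (c : ℂ) : BddMeas fun x => c * g x := (const c).mul hg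

lemma conj (hg : BddMeas g) : BddMeas fun x => (starRingEnd ℂ) (g x) := by
  obtain ⟨C, hC⟩ := hg.2
  exact ⟨Complex.continuous_conj.measurable.comp hg.1, C, fun x => by simpa using hC x⟩

lemma comp (hg : BddMeas g) {u : ℝ → ℝ} (hu : Measurable u) : BddMeas fun x => g (u x) :=
  ⟨hg.1.comp hu, hg.2.imp fun _ hC _ => hC _⟩

lemma indicator {s : Set ℝ} (hs : MeasurableSet s) : BddMeas (s.indicator fun _ => (1 : ℂ)) := by
  refine ⟨measurable_const.indicator hs, 1, fun x => ?_⟩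
  by_cases hx : x ∈ s <;> simp [hx]

lemma integrable (hg : BddMeas g) (μ : Measure ℝ) [IsFiniteMeasure μ] : Integrable g μ := by
  obtain ⟨C, hC⟩ := hg.2
  exact Integrable.of_bound hg.1.aestronglyMeasurable C (Eventually.of_forall hC)

lemma of_tendsto {g : ℕ → ℝ → ℂ} {G : ℝ → ℂ} {C : ℝ} (hg : ∀ n, Measurable (g n))
    (hC : ∀ n x, ‖g n x‖ ≤ C) (hl : ∀ x, Tendsto (fun n => g n x) atTop (𝓝 (G x))) : BddMeas G :=
  ⟨measurable_of_tendsto_metrizable hg (tendsto_pi_nhds.2 hl), C,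
    fun x => le_of_tendsto (hl x).norm (Eventually.of_forall fun n => hC n x)⟩

/-- Induction principle for bounded measurable functions: a property which holds for indicators
and is stable under linear combinations and bounded pointwise limits holds for all of them. -/
lemma induction {p : (ℝ → ℂ) → Prop}
    (hind : ∀ s, MeasurableSet s → p (s.indicator fun _ => 1))
    (hadd : ∀ f g, BddMeas f → BddMeas g → p f → p g → p fun x => f x + g x)
    (hmul : ∀ (c : ℂ) f, BddMeas f → p f → p fun x => c * f x)
    (hlim : ∀ (f : ℕ → ℝ → ℂ) (F : ℝ → ℂ) (C : ℝ), (∀ n, Measurable (f n)) →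
      (∀ n x, ‖f n x‖ ≤ C) → (∀ x, Tendsto (fun n => f n x) atTop (𝓝 (F x))) →
      (∀ n, p (f n)) → p F)
    (hg : BddMeas g) : p g := by
  have hsimple : ∀ f : SimpleFunc ℝ ℂ, BddMeas f ∧ p f := by
    intro f
    induction f using SimpleFunc.induction with
    | const c hs =>
      rename_i s
      have h1 : (⇑(SimpleFunc.piecewise s hs (SimpleFunc.const ℝ c) (SimpleFunc.const ℝ 0)) : ℝ → ℂ)
          = fun x => c * s.indicator (fun _ => 1) x := by
        ext x
        by_cases hx : x ∈ s <;> simp [hx]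
      rw [h1]
      exact ⟨(indicator hs).const_mul c, hmul c _ (indicator hs) (hind s hs)⟩
    | add _ h1 h2 =>
      exact ⟨h1.1.add h2.1, hadd _ _ h1.1 h2.1 h1.2 h2.2⟩
  obtain ⟨C, hC0, hC⟩ := hg.bound
  have hs := hg.1.stronglyMeasurable
  exact hlim (fun n => hs.approxBounded C n) g C (fun n => SimpleFunc.measurable _)
    (fun n x => hs.norm_approxBounded_le hC0 n x)
    (fun x => hs.tendsto_approxBounded_of_norm_le (hC x)) (fun n => (hsimple _).2)

end BddMeas

lemma opEq_of_inner_self {A B : 𝓗 →L[ℂ] 𝓗} (h : ∀ x, ⟪x, A x⟫_ℂ = ⟪x, B x⟫_ℂ) : A = B := by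
  have h1 : (A : 𝓗 →ₗ[ℂ] 𝓗) = B := by
    refine (ext_inner_map _ _).1 fun x => ?_
    rw [← inner_conj_symm, ← inner_conj_symm ((B : 𝓗 →ₗ[ℂ] 𝓗) x)]
    exact congrArg _ (h x)
  exact ContinuousLinearMap.coe_injective h1

lemma tendsto_inner_of_inner_self {S : ℕ → 𝓗 →L[ℂ] 𝓗} {S' : 𝓗 →L[ℂ] 𝓗}
    (hS : ∀ x, Tendsto (fun n => ⟪x, S n x⟫_ℂ) atTop (𝓝 ⟪x, S' x⟫_ℂ)) (x y : 𝓗) :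
    Tendsto (fun n => ⟪x, S n y⟫_ℂ) atTop (𝓝 ⟪x, S' y⟫_ℂ) := by
  have hS' : ∀ x, Tendsto (fun n => ⟪S n x, x⟫_ℂ) atTop (𝓝 ⟪S' x, x⟫_ℂ) := by
    intro x
    have := (Complex.continuous_conj.tendsto _).comp (hS x)
    simpa [Function.comp_def] using this
  have h1 : ∀ x y, Tendsto (fun n => ⟪S n x, y⟫_ℂ) atTop (𝓝 ⟪S' x, y⟫_ℂ) := by
    intro x y
    have key := fun T : 𝓗 →L[ℂ] 𝓗 => inner_map_polarization' (T : 𝓗 →ₗ[ℂ] 𝓗) x y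
    simp only [ContinuousLinearMap.coe_coe] at key
    simp only [key]
    exact ((((hS' _).sub (hS' _)).sub ((hS' _).const_mul I)).add ((hS' _).const_mul I)).div_const 4
  have := (Complex.continuous_conj.tendsto _).comp (h1 y x)
  simpa [Function.comp_def] using this

namespace SpectralMeasure

variable {H : SelfAdjointOperator 𝓗} (E : SpectralMeasure H) {g h : ℝ → ℂ}

instance (x : 𝓗) : IsFiniteMeasure (E.scalar x) := E.scalar_finite x

lemma fc_inner (hg : BddMeas g) (x : 𝓗) : ⟪x, E.fc g x⟫_ℂ = ∫ t, g t ∂(E.scalar x) :=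
  E.fc_spec g hg.1 hg.2 x

lemma fc_add (hg : BddMeas g) (hh : BddMeas h) :
    E.fc (fun x => g x + h x) = E.fc g + E.fc h := by
  refine opEq_of_inner_self fun x => ?_
  rw [add_apply, inner_add_right, E.fc_inner (hg.add hh), E.fc_inner hg, E.fc_inner hh,
    integral_add (hg.integrable _) (hh.integrable _)]

lemma fc_const_mul (hg : BddMeas g) (c : ℂ) : E.fc (fun x => c * g x) = c • E.fc g := by
  refine opEq_of_inner_self fun x => ?_
  rw [smul_apply, inner_smul_right, E.fc_inner (hg.const_mul c), E.fc_inner hg, integral_const_mul]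

lemma fc_sub (hg : BddMeas g) (hh : BddMeas h) :
    E.fc (fun x => g x - h x) = E.fc g - E.fc h := by
  have h1 := E.fc_add hg (hh.const_mul (-1))
  rw [E.fc_const_mul hh] at h1
  simpa [sub_eq_add_neg] using h1

lemma fc_indicator {s : Set ℝ} (hs : MeasurableSet s) :
    E.fc (s.indicator fun _ => 1) = E.proj s := by
  refine opEq_of_inner_self fun x => ?_
  rw [E.fc_inner (.indicator hs), integral_indicator_const _ hs, Measure.real, E.scalar_spec x s hs]
  have h1 : (starRingEnd ℂ) ⟪x, E.proj s x⟫_ℂ = ⟪x, E.proj s x⟫_ℂ := by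
    rw [inner_conj_symm, ← ContinuousLinearMap.adjoint_inner_right,
      ← ContinuousLinearMap.star_eq_adjoint, (E.proj_sa s).star_eq]
  rw [Complex.conj_eq_iff_re] at h1
  simpa using h1

lemma fc_one : E.fc (fun _ => 1) = 1 := by
  have := E.fc_indicator MeasurableSet.univ
  rwa [indicator_univ, E.proj_univ] at this

lemma bddMeas_resolvent {z : ℂ} (hz : z.im ≠ 0) : BddMeas fun x : ℝ => ((x : ℂ) - z)⁻¹ := by
  refine ⟨by fun_prop, |z.im|⁻¹, fun x => ?_⟩
  rw [norm_inv]
  have h1 : |z.im| ≤ ‖(x : ℂ) - z‖ := by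
    simpa using Complex.abs_im_le_norm ((x : ℂ) - z)
  exact inv_anti₀ (abs_pos.2 hz) h1

lemma fc_resolvent {z : ℂ} (hz : z.im ≠ 0) :
    E.fc (fun x : ℝ => ((x : ℂ) - z)⁻¹) = H.resolvent z := by
  refine opEq_of_inner_self fun x => ?_
  rw [E.fc_inner (bddMeas_resolvent hz), E.resolvent_spec z hz]

lemma fc_conj (hg : BddMeas g) : E.fc (fun x => (starRingEnd ℂ) (g x)) = star (E.fc g) := by
  refine opEq_of_inner_self fun x => ?_
  rw [E.fc_inner hg.conj, integral_conj, ← E.fc_inner hg, ContinuousLinearMap.star_eq_adjoint,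
    ContinuousLinearMap.adjoint_inner_right, inner_conj_symm]

lemma tendsto_fc_inner {g : ℕ → ℝ → ℂ} {G : ℝ → ℂ} {C : ℝ} (hg : ∀ n, Measurable (g n))
    (hC : ∀ n x, ‖g n x‖ ≤ C) (hl : ∀ x, Tendsto (fun n => g n x) atTop (𝓝 (G x))) (x : 𝓗) :
    Tendsto (fun n => ⟪x, E.fc (g n) x⟫_ℂ) atTop (𝓝 ⟪x, E.fc G x⟫_ℂ) := by
  simp only [fun n => E.fc_inner ⟨hg n, C, hC n⟩ x, E.fc_inner (.of_tendsto hg hC hl)]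
  exact tendsto_integral_of_dominated_convergence (fun _ => C)
    (fun n => (hg n).aestronglyMeasurable) (integrable_const C)
    (fun n => Eventually.of_forall (hC n)) (Eventually.of_forall hl)

lemma fc_mul (hg : BddMeas g) (hh : BddMeas h) :
    E.fc (fun x => g x * h x) = E.fc g * E.fc h := by
  have hstep : ∀ {h : ℝ → ℂ}, BddMeas h → (∀ s, MeasurableSet s →
      E.fc (fun x => s.indicator (fun _ => 1) x * h x) = E.fc (s.indicator fun _ => 1) * E.fc h) →
      ∀ {g : ℝ → ℂ}, BddMeas g → E.fc (fun x => g x * h x) = E.fc g * E.fc h := by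
    intro h hh hs g hg
    refine hg.induction (p := fun g => E.fc (fun x => g x * h x) = E.fc g * E.fc h) hs ?_ ?_ ?_
    · intro f g hf hg h1 h2
      simp only [add_mul]
      rw [E.fc_add (hf.mul hh) (hg.mul hh), E.fc_add hf hg, add_mul, h1, h2]
    · intro c f hf h1
      simp only [mul_assoc]
      rw [E.fc_const_mul (hf.mul hh), E.fc_const_mul hf, h1, smul_mul_assoc]
    · intro f F C hf hC hl h1
      refine opEq_of_inner_self fun x => ?_
      obtain ⟨D, hD0, hD⟩ := hh.bound
      have hC0 : 0 ≤ C := (norm_nonneg _).trans (hC 0 0)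
      have t1 := E.tendsto_fc_inner (g := fun n x => f n x * h x) (G := fun x => F x * h x)
        (C := C * D) (fun n => (hf n).mul hh.1)
        (fun n x => by rw [norm_mul]; exact mul_le_mul (hC n x) (hD x) (norm_nonneg _) hC0)
        (fun x => (hl x).mul_const _) x
      have t2 := tendsto_inner_of_inner_self (E.tendsto_fc_inner hf hC hl) x (E.fc h x)
      refine tendsto_nhds_unique t1 (t2.congr fun n => ?_)
      rw [h1 n]; rfl
  refine hstep hh (fun s hs => ?_) hg
  have h3 := congrArg star (hstep (.indicator hs) (fun t ht => ?_) hh.conj)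
  · rw [star_mul, ← E.fc_conj (.indicator hs), ← E.fc_conj hh.conj,
      ← E.fc_conj (hh.conj.mul (.indicator hs))] at h3
    have h4 : ∀ x, (starRingEnd ℂ) (s.indicator (fun _ => (1 : ℂ)) x)
        = s.indicator (fun _ => 1) x := by
      intro x
      by_cases hx : x ∈ s <;> simp [hx]
    simp only [map_mul, Complex.conj_conj, h4] at h3
    rw [← h3]
    simp only [mul_comm]
  · have h5 : (fun x => t.indicator (fun _ => (1 : ℂ)) x * s.indicator (fun _ => 1) x)
        = (t ∩ s).indicator fun _ => 1 := by
      ext x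
      by_cases hx : x ∈ s <;> by_cases hx' : x ∈ t <;> simp [hx, hx']
    rw [h5, E.fc_indicator hs, E.fc_indicator ht, E.fc_indicator (ht.inter hs), E.proj_mul]
    rfl

lemma norm_fc_le {C : ℝ} (hg : BddMeas g) (hC : ∀ x, ‖g x‖ ≤ C) : ‖E.fc g‖ ≤ C := by
  have hC0 : 0 ≤ C := (norm_nonneg _).trans (hC 0)
  refine ContinuousLinearMap.opNorm_le_bound _ hC0 fun x => ?_
  have h1 : ⟪E.fc g x, E.fc g x⟫_ℂ = ∫ t, (starRingEnd ℂ) (g t) * g t ∂(E.scalar x) := by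
    rw [← E.fc_inner (hg.conj.mul hg), E.fc_mul hg.conj hg, E.fc_conj hg, mul_apply_eq_comp,
      ContinuousLinearMap.star_eq_adjoint, ContinuousLinearMap.adjoint_inner_right]
  have h2 : (E.scalar x).real univ = ‖x‖ ^ 2 := by
    rw [Measure.real, E.scalar_spec x _ MeasurableSet.univ, E.proj_univ]
    rw [one_apply_eq_self, inner_self_eq_norm_sq_to_K]
    norm_cast
  have h3 : ‖∫ t, (starRingEnd ℂ) (g t) * g t ∂(E.scalar x)‖ ≤ C ^ 2 * ‖x‖ ^ 2 := by
    rw [← h2]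
    refine norm_integral_le_of_norm_le_const (Eventually.of_forall fun t => ?_)
    rw [norm_mul, RCLike.norm_conj, ← sq]
    exact pow_le_pow_left₀ (norm_nonneg _) (hC t) 2
  rw [← h1, inner_self_eq_norm_sq_to_K, norm_pow, RCLike.norm_ofReal, abs_norm, ← mul_pow] at h3
  exact (pow_le_pow_iff_left₀ (norm_nonneg _) (by positivity) two_ne_zero).1 h3

lemma hasSum_fc {ι : Type*} [Countable ι] {g : ι → ℝ → ℂ} {a : ι → ℝ} {G : ℝ → ℂ} (ha : Summable a)
    (hg : ∀ n, Measurable (g n)) (hb : ∀ n x, ‖g n x‖ ≤ a n) (hG : BddMeas G)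
    (hs : ∀ x, HasSum (fun n => g n x) (G x)) : HasSum (fun n => E.fc (g n)) (E.fc G) := by
  have hgb : ∀ n, BddMeas (g n) := fun n => ⟨hg n, a n, hb n⟩
  have h1 : Summable fun n => E.fc (g n) :=
    Summable.of_norm_bounded ha fun n => E.norm_fc_le (hgb n) (hb n)
  convert h1.hasSum using 1
  refine opEq_of_inner_self fun x => ?_
  have h2 : HasSum (fun n => ⟪x, E.fc (g n) x⟫_ℂ) ⟪x, (∑' n, E.fc (g n)) x⟫_ℂ :=
    h1.hasSum.mapL ((innerSL ℂ x).comp (ContinuousLinearMap.apply ℂ 𝓗 x))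
  have h3 := hasSum_integral_of_summable_integral_norm (μ := E.scalar x) (F := g)
    (fun n => (hgb n).integrable _) ?_
  · simp only [fun n => E.fc_inner (hgb n) x] at h2
    rw [E.fc_inner hG, h2.unique h3]
    exact integral_congr_ae (Eventually.of_forall fun t => (hs t).tsum_eq.symm)
  · refine Summable.of_nonneg_of_le (fun n => integral_nonneg fun _ => norm_nonneg _) (fun n => ?_)
      (ha.mul_right ((E.scalar x).real univ))
    have := norm_integral_le_of_norm_le_const (μ := E.scalar x) (f := fun t => ‖g n t‖) (C := a n)
      (Eventually.of_forall fun t => by simpa using hb n t)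
    exact (le_abs_self _).trans this

end SpectralMeasure

lemma bddMeas_cayley_zpow (n : ℤ) : BddMeas fun x => cayley x ^ n :=
  ⟨measurable_cayley.pow_const n, 1, fun x => by rw [norm_zpow, norm_cayley, one_zpow]⟩

/-- The functional `B ↦ Tr (T B)` attached to a trace class operator. -/
def traceMul {T : 𝓗 →L[ℂ] 𝓗} (hT : IsTraceClass T) : (𝓗 →L[ℂ] 𝓗) →L[ℂ] ℂ :=
  LinearMap.mkContinuousOfExistsBound
    { toFun := fun B => trace (T * B)
      map_add' := fun A B => by rw [mul_add, trace_add (hT.mul_right _) (hT.mul_right _)]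
      map_smul' := fun c B => by rw [mul_smul_comm, trace_smul]; rfl }
    (by
      obtain ⟨C, hC⟩ := hT
      refine ⟨2 * C, fun B => ?_⟩
      refine (TraceBound.norm_trace_le (TraceBound.mul_right hC B)).trans (le_of_eq ?_)
      ring)

lemma traceMul_apply {T : 𝓗 →L[ℂ] 𝓗} (hT : IsTraceClass T) (B : 𝓗 →L[ℂ] 𝓗) :
    traceMul hT B = trace (T * B) := rfl

variable (𝓗) in
/-- A straight line path `H r = H 0 + r V` of self-adjoint operators, described through its
resolvents at `-i`, along which `R V R` is trace class. -/
structure TracePath where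
  H : ℝ → SelfAdjointOperator 𝓗
  E : ∀ r, SpectralMeasure (H r)
  V : 𝓗 →L[ℂ] 𝓗
  resolvent_sub : ∀ r s : ℝ, (H r).resolvent (-I) - (H s).resolvent (-I) =
    ((s : ℂ) - r) • ((H r).resolvent (-I) * V * (H s).resolvent (-I))
  isTraceClass : IsTraceClass ((H 0).resolvent (-I) * V * (H 0).resolvent (-I))

namespace TracePath

variable (P : TracePath 𝓗)

/-- The resolvent at `-i`. -/
def R (r : ℝ) : 𝓗 →L[ℂ] 𝓗 := (P.H r).resolvent (-I)

/-- The sandwiched perturbation at the time `r`. -/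
def T (r : ℝ) : 𝓗 →L[ℂ] 𝓗 := P.R r * P.V * P.R r

/-- Integer powers of the Cayley transform. -/
def U (n : ℤ) (r : ℝ) : 𝓗 →L[ℂ] 𝓗 := (P.E r).fc fun x => cayley x ^ n

/-- The left factor in `R r = L r * R 0`. -/
def L (r : ℝ) : 𝓗 →L[ℂ] 𝓗 := 1 - (r : ℂ) • (P.R r * P.V)

/-- The right factor in `R r = R 0 * M r`. -/
def M (r : ℝ) : 𝓗 →L[ℂ] 𝓗 := 1 - (r : ℂ) • (P.V * P.R r)

lemma R_sub (r s : ℝ) : P.R r - P.R s = ((s : ℂ) - r) • (P.R r * P.V * P.R s) :=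
  P.resolvent_sub r s

lemma R_eq_fc (r : ℝ) : P.R r = (P.E r).fc fun x : ℝ => ((x : ℂ) - (-I))⁻¹ :=
  ((P.E r).fc_resolvent (by simp)).symm

lemma norm_R_le (r : ℝ) : ‖P.R r‖ ≤ 1 := by
  rw [R_eq_fc]
  refine (P.E r).norm_fc_le (SpectralMeasure.bddMeas_resolvent (by simp)) fun x => ?_
  rw [norm_inv]
  refine inv_le_one_of_one_le₀ ?_
  simpa using Complex.abs_im_le_norm ((x : ℂ) - (-I))

lemma R_eq_L_mul (r : ℝ) : P.R r = P.L r * P.R 0 := by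
  have h := P.R_sub r 0
  rw [L, sub_mul, one_mul, smul_mul_assoc]
  rw [← sub_eq_zero] at h ⊢
  rw [← h]
  simp only [ofReal_zero, zero_sub, neg_smul]
  abel

lemma R_eq_mul_M (r : ℝ) : P.R r = P.R 0 * P.M r := by
  have h := P.R_sub 0 r
  rw [M, mul_sub, mul_one, mul_smul_comm, ← mul_assoc]
  rw [← sub_eq_zero] at h ⊢
  rw [← neg_eq_zero, ← h]
  simp only [ofReal_zero, sub_zero]
  abel

lemma sandwich_eq (r s : ℝ) : P.R r * P.V * P.R s = P.L r * P.T 0 * P.M s := by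
  rw [P.R_eq_L_mul r, P.R_eq_mul_M s, T]
  simp only [mul_assoc]

lemma continuous_R : Continuous P.R := by
  have h : LipschitzWith ‖P.V‖₊ P.R := by
    refine LipschitzWith.of_dist_le_mul fun r s => ?_
    rw [dist_eq_norm, R_sub, norm_smul, Real.dist_eq, mul_comm, abs_sub_comm]
    have h1 : ‖((s : ℂ) - r)‖ = |s - r| := by
      rw [← ofReal_sub, Complex.norm_real, Real.norm_eq_abs]
    rw [h1]
    refine mul_le_mul_of_nonneg_right ?_ (abs_nonneg _)
    calc ‖P.R r * P.V * P.R s‖ ≤ ‖P.R r‖ * ‖P.V‖ * ‖P.R s‖ :=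
          (norm_mul_le _ _).trans (by gcongr; exact norm_mul_le _ _)
      _ ≤ 1 * ‖P.V‖ * 1 := by gcongr <;> exact P.norm_R_le _
      _ = ‖P.V‖₊ := by simp
  exact h.continuous

lemma continuous_L : Continuous P.L := by
  have := P.continuous_R
  unfold L
  fun_prop

lemma continuous_M : Continuous P.M := by
  have := P.continuous_R
  unfold M
  fun_prop

lemma U_zero (r : ℝ) : P.U 0 r = 1 := by
  simp [U, SpectralMeasure.fc_one]

lemma U_add (m n : ℤ) (r : ℝ) : P.U (m + n) r = P.U m r * P.U n r := by
  rw [U, U, U, ← (P.E r).fc_mul (bddMeas_cayley_zpow m) (bddMeas_cayley_zpow n)]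
  simp only [zpow_add₀ (cayley_ne_zero _)]

lemma norm_U_le (n : ℤ) (r : ℝ) : ‖P.U n r‖ ≤ 1 :=
  (P.E r).norm_fc_le (bddMeas_cayley_zpow n) fun x => by rw [norm_zpow, norm_cayley, one_zpow]

lemma U_one (r : ℝ) : P.U 1 r = -1 + (2 * I) • P.R r := by
  have hb : BddMeas fun x : ℝ => ((x : ℂ) - (-I))⁻¹ :=
    SpectralMeasure.bddMeas_resolvent (by simp)
  have h := (P.E r).fc_add (.const (-1)) (hb.const_mul (2 * I))
  rw [(P.E r).fc_const_mul hb, ← R_eq_fc] at h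
  have h1 := (P.E r).fc_const_mul (.const 1) (-1)
  simp only [mul_one, (P.E r).fc_one, neg_one_smul] at h1
  rw [U, ← h1, ← h]
  simp only [zpow_one]
  rfl

lemma U_one_sub (s r : ℝ) :
    P.U 1 s - P.U 1 r = (2 * I * ((r : ℂ) - s)) • (P.L s * P.T 0 * P.M r) := by
  rw [U_one, U_one, add_sub_add_left_eq_sub, ← smul_sub, R_sub, smul_smul, sandwich_eq]

lemma U_neg (n : ℤ) (r : ℝ) : P.U (-n) r = star (P.U n r) := by
  rw [U, U, ← (P.E r).fc_conj (bddMeas_cayley_zpow n)]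
  congr 1
  ext x
  rw [map_zpow₀, zpow_neg, ← inv_zpow, Complex.inv_eq_conj (norm_cayley x)]

lemma continuous_U (n : ℤ) : Continuous (P.U n) := by
  have h1 : Continuous (P.U 1) := by
    have := P.continuous_R
    simp only [funext P.U_one]
    fun_prop
  have hn : ∀ m : ℕ, Continuous (P.U m) := by
    intro m
    induction m with
    | zero => simpa only [Nat.cast_zero, funext P.U_zero] using continuous_const
    | succ m ih =>
      simp only [Nat.cast_succ, funext (P.U_add m 1)]
      exact ih.mul h1
  obtain ⟨m, rfl | rfl⟩ := n.eq_nat_or_neg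
  · exact hn m
  · simp only [funext (P.U_neg m)]
    exact (hn m).star

/-- Telescoping of differences of powers. -/
lemma exists_telescope (n : ℤ) : ∃ (ε : ℤ) (a : ℕ → ℤ), |ε| = 1 ∧ ε * n.natAbs = n ∧ ∀ s r : ℝ,
    P.U n s - P.U n r = (ε : ℂ) • ∑ k ∈ Finset.range n.natAbs,
      P.U (a k) s * (P.U 1 s - P.U 1 r) * P.U (n - 1 - a k) r := by
  obtain ⟨m, rfl | rfl⟩ := n.eq_nat_or_neg
  · refine ⟨1, fun k => k, by simp, by simp, fun s r => ?_⟩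
    have h := Finset.sum_range_sub (fun k : ℕ => P.U k s * P.U (m - k) r) m
    simp only [sub_self, U_zero, mul_one, Nat.cast_zero, one_mul, sub_zero] at h
    rw [← h, Int.natAbs_natCast, Int.cast_one, one_smul]
    refine Finset.sum_congr rfl fun k _ => ?_
    have e : (m : ℤ) - k = 1 + (m - 1 - k) := by ring
    rw [Nat.cast_succ, U_add, e, U_add, mul_sub, sub_mul, show (m : ℤ) - (k + 1) = m - 1 - k by ring]
    simp only [mul_assoc]
  · refine ⟨-1, fun k => -k - 1, by simp, by simp, fun s r => ?_⟩
    have h := Finset.sum_range_sub (fun k : ℕ => P.U (-k) s * P.U (-m + k) r) m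
    simp only [neg_add_cancel, U_zero, mul_one, Nat.cast_zero, one_mul, neg_zero, add_zero] at h
    rw [← h, Int.natAbs_neg, Int.natAbs_natCast, Int.cast_neg, Int.cast_one, neg_one_smul,
      ← Finset.sum_neg_distrib]
    refine Finset.sum_congr rfl fun k _ => ?_
    beta_reduce
    rw [Nat.cast_succ, mul_sub, sub_mul, ← U_add, mul_assoc _ (P.U 1 r), ← U_add]
    rw [show (-k - 1 + 1 : ℤ) = -k by ring, show (-m - 1 - (-k - 1) : ℤ) = -m + k by ring,
      show (1 + (-m + k) : ℤ) = -m + (k + 1) by ring, show (-(k + 1) : ℤ) = -k - 1 by ring]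
    abel

lemma exists_traceBound_U_sub : ∃ K : ℝ, ∀ n : ℤ,
    TraceBound (P.U n 1 - P.U n 0) (K * |(n : ℝ)|) := by
  obtain ⟨C, hC⟩ : ∃ C, TraceBound (P.U 1 1 - P.U 1 0) C := by
    rw [U_one_sub]
    exact ((P.isTraceClass.mul_left _).mul_right _).smul _
  refine ⟨2 * 1 * (2 * 1 * C), fun n => ?_⟩
  have hC0 := hC.nonneg
  obtain ⟨ε, a, hε, hn, h⟩ := P.exists_telescope n
  rw [h]
  have h1 : ∀ k ∈ Finset.range n.natAbs, TraceBound
      (P.U (a k) 1 * (P.U 1 1 - P.U 1 0) * P.U (n - 1 - a k) 0) (2 * 1 * (2 * 1 * C)) := by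
    intro k _
    refine ((hC.mul_left _).mul_right _).mono ?_
    gcongr <;> exact P.norm_U_le _ _
  refine ((TraceBound.sum _ h1).smul _).mono (le_of_eq ?_)
  rw [Complex.norm_intCast, ← Int.cast_abs, hε, Finset.sum_const, Finset.card_range, nsmul_eq_mul,
    Nat.cast_natAbs]
  push_cast
  ring

lemma isTraceClass_U_sub (n : ℤ) (s r : ℝ) : IsTraceClass (P.U n s - P.U n r) := by
  obtain ⟨ε, a, hε, hn, h⟩ := P.exists_telescope n
  rw [h]
  refine IsTraceClass.smul ?_ _
  choose C hC using fun k : ℕ => show IsTraceClass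
    (P.U (a k) s * (P.U 1 s - P.U 1 r) * P.U (n - 1 - a k) r) by
      rw [U_one_sub]
      exact ((((P.isTraceClass.mul_left _).mul_right _).smul _).mul_left _).mul_right _
  exact ⟨_, TraceBound.sum _ fun k _ => hC k⟩

lemma isTraceClass_T_zero : IsTraceClass (P.T 0) := P.isTraceClass

lemma trace_T_mul (r : ℝ) (B : 𝓗 →L[ℂ] 𝓗) :
    trace (P.T r * B) = traceMul P.isTraceClass_T_zero (P.M r * B * P.L r) := by
  rw [T, sandwich_eq, mul_assoc, mul_assoc, trace_mul_comm (P.isTraceClass_T_zero.mul_right _)]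
  simp only [traceMul_apply, mul_assoc]

lemma hasDerivAt_trace (n : ℤ) (r : ℝ) : HasDerivAt (fun s => trace (P.U n s - P.U n 0))
    (-2 * I * n * trace (P.T r * P.U (n - 1) r)) r := by
  obtain ⟨ε, a, hε, hn, h⟩ := P.exists_telescope n
  set G : ℝ → ℂ := fun s => (ε : ℂ) * ∑ k ∈ Finset.range n.natAbs,
    (-2 * I) * traceMul P.isTraceClass_T_zero (P.M r * P.U (n - 1 - a k) r * (P.U (a k) s * P.L s)) with hG
  have hGc : Continuous G := by
    have h1 := P.continuous_L
    have h2 := fun k => P.continuous_U (a k)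
    fun_prop
  have hF : ∀ s, trace (P.U n s - P.U n 0) - trace (P.U n r - P.U n 0) = ((s - r : ℝ) : ℂ) * G s := by
    intro s
    have e1 : trace (P.U n s - P.U n 0) = trace (P.U n s - P.U n r) + trace (P.U n r - P.U n 0) := by
      rw [← trace_add (P.isTraceClass_U_sub _ _ _) (P.isTraceClass_U_sub _ _ _), sub_add_sub_cancel]
    rw [e1, add_sub_cancel_right, h, trace_smul]
    have e2 : ∀ k, P.U (a k) s * (P.U 1 s - P.U 1 r) * P.U (n - 1 - a k) r =
        (2 * I * ((r : ℂ) - s)) • ((P.U (a k) s * P.L s) * (P.T 0 * (P.M r * P.U (n - 1 - a k) r))) := by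
      intro k
      rw [U_one_sub, mul_smul_comm, smul_mul_assoc]
      simp only [mul_assoc]
    have e3 : ∀ k, IsTraceClass (P.T 0 * (P.M r * P.U (n - 1 - a k) r)) :=
      fun k => P.isTraceClass_T_zero.mul_right _
    simp only [e2]
    rw [trace_sum _ fun k _ => ((e3 k).mul_left _).smul _, hG, mul_left_comm]
    congr 1
    rw [Finset.mul_sum]
    refine Finset.sum_congr rfl fun k _ => ?_
    rw [trace_smul, trace_mul_comm (e3 k), traceMul_apply]
    simp only [mul_assoc]
    push_cast
    ring
  have hGr : G r = -2 * I * n * trace (P.T r * P.U (n - 1) r) := by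
    have e4 : ∀ k, P.M r * P.U (n - 1 - a k) r * (P.U (a k) r * P.L r)
        = P.M r * P.U (n - 1) r * P.L r := by
      intro k
      rw [mul_assoc, ← mul_assoc (P.U (n - 1 - a k) r), ← U_add, sub_add_cancel, mul_assoc]
    simp only [hG, e4]
    rw [Finset.sum_const, Finset.card_range, nsmul_eq_mul, ← trace_T_mul]
    have hn' : (n : ℂ) = (ε : ℂ) * (n.natAbs : ℂ) := by
      conv_lhs => rw [← hn]
      rw [Int.cast_mul, Int.cast_natCast]
    rw [hn']
    ring
  rw [hasDerivAt_iff_tendsto_slope, ← hGr]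
  refine (hGc.continuousAt.tendsto.mono_left nhdsWithin_le_nhds).congr' ?_
  filter_upwards [self_mem_nhdsWithin] with s hs
  have hs' : ((s - r : ℝ) : ℂ) ≠ 0 := by
    rw [Ne, ofReal_eq_zero, sub_eq_zero]; exact hs
  rw [slope_def_module, hF, Complex.real_smul, ofReal_inv, inv_mul_cancel_left₀ hs']

end TracePath

/-- Multiplication by the square of `x + i`. -/
def weight (g : ℝ → ℂ) : ℝ → ℂ := fun x => g x * ((x : ℂ) - (-I)) ^ 2

lemma BddMeas.mul_continuous {g u : ℝ → ℂ} (hg : BddMeas g) (hc : HasCompactSupport g)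
    (hu : Continuous u) : BddMeas fun x => g x * u x := by
  obtain ⟨C, hC0, hC⟩ := hg.bound
  obtain ⟨D, hD⟩ := hc.isCompact.exists_bound_of_continuousOn hu.continuousOn
  refine ⟨hg.1.mul hu.measurable, C * max D 0, fun x => ?_⟩
  by_cases hx : x ∈ tsupport g
  · rw [norm_mul]
    exact mul_le_mul (hC x) ((hD x hx).trans (le_max_left _ _)) (norm_nonneg _) hC0
  · beta_reduce
    rw [image_eq_zero_of_notMem_tsupport hx, zero_mul, norm_zero]
    positivity

lemma BddMeas.weight {g : ℝ → ℂ} (hg : BddMeas g) (hc : HasCompactSupport g) :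
    BddMeas (weight g) := hg.mul_continuous hc (by fun_prop)

lemma bddMeas_ofReal {ψ : ℝ → ℝ} (hψ : Continuous ψ) (hc : HasCompactSupport ψ) :
    BddMeas fun x => (ψ x : ℂ) := by
  obtain ⟨C, hC⟩ := hψ.bounded_above_of_compact_support hc
  exact ⟨by fun_prop, C, fun x => by simpa using hC x⟩

lemma hasCompactSupport_ofReal {ψ : ℝ → ℝ} (hc : HasCompactSupport ψ) :
    HasCompactSupport fun x => (ψ x : ℂ) := hc.comp_left ofReal_zero

namespace TracePath

variable (P : TracePath 𝓗)

lemma exists_norm_trace_le : ∃ K : ℝ, 0 ≤ K ∧ ∀ r ∈ Icc (0 : ℝ) 1, ∀ B : 𝓗 →L[ℂ] 𝓗,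
    ‖trace (P.T r * B)‖ ≤ K * ‖B‖ := by
  refine ⟨‖traceMul P.isTraceClass_T_zero‖ * ((1 + ‖P.V‖) * (1 + ‖P.V‖)), by positivity,
    fun r hr B => ?_⟩
  have hr1 : ‖(r : ℂ)‖ ≤ 1 := by
    rw [Complex.norm_real, Real.norm_of_nonneg hr.1]; exact hr.2
  have h1 : ‖(1 : 𝓗 →L[ℂ] 𝓗)‖ ≤ 1 := ContinuousLinearMap.norm_id_le
  have hL : ‖P.L r‖ ≤ 1 + ‖P.V‖ := by
    refine (norm_sub_le _ _).trans (add_le_add h1 ?_)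
    rw [norm_smul]
    calc ‖(r : ℂ)‖ * ‖P.R r * P.V‖ ≤ 1 * (1 * ‖P.V‖) := by
          gcongr
          exact (norm_mul_le _ _).trans (by gcongr; exact P.norm_R_le r)
      _ = ‖P.V‖ := by ring
  have hM : ‖P.M r‖ ≤ 1 + ‖P.V‖ := by
    refine (norm_sub_le _ _).trans (add_le_add h1 ?_)
    rw [norm_smul]
    calc ‖(r : ℂ)‖ * ‖P.V * P.R r‖ ≤ 1 * (‖P.V‖ * 1) := by
          gcongr
          exact (norm_mul_le _ _).trans (by gcongr; exact P.norm_R_le r)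
      _ = ‖P.V‖ := by ring
  rw [trace_T_mul]
  calc _ ≤ ‖traceMul P.isTraceClass_T_zero‖ * ‖P.M r * B * P.L r‖ := ContinuousLinearMap.le_opNorm _ _
    _ ≤ ‖traceMul P.isTraceClass_T_zero‖ * ((1 + ‖P.V‖) * ‖B‖ * (1 + ‖P.V‖)) := by
        gcongr
        refine (norm_mul_le _ _).trans ?_
        gcongr
        refine (norm_mul_le _ _).trans ?_
        gcongr
    _ = _ := by ring

lemma continuous_trace_T_mul_U (n : ℤ) : Continuous fun r => trace (P.T r * P.U n r) := by
  have h1 := P.continuous_L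
  have h2 := P.continuous_M
  have h3 := P.continuous_U n
  simp only [trace_T_mul]
  fun_prop

lemma trace_U_sub (n : ℤ) : trace (P.U n 1 - P.U n 0) =
    ∫ r in (0 : ℝ)..1, -2 * I * n * trace (P.T r * P.U (n - 1) r) := by
  rw [intervalIntegral.integral_eq_sub_of_hasDerivAt (fun r _ => P.hasDerivAt_trace n r)
    ((continuous_const.mul (P.continuous_trace_T_mul_U (n - 1))).intervalIntegrable 0 1)]
  have h0 := trace_smul 0 (0 : 𝓗 →L[ℂ] 𝓗)
  rw [zero_smul, zero_mul] at h0
  rw [sub_self (P.U n 0), h0, sub_zero]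

lemma trace_formula {ψ : ℝ → ℝ} (hψ : ContDiff ℝ (⊤ : ℕ∞) ψ) (hc : HasCompactSupport ψ) :
    IsTraceClass ((P.E 1).fcR ψ - (P.E 0).fcR ψ) ∧
    ContinuousOn (fun r => trace (P.T r * (P.E r).fc (weight fun x => ((deriv ψ x : ℝ) : ℂ)))) (Icc 0 1) ∧
    trace ((P.E 1).fcR ψ - (P.E 0).fcR ψ) =
      ∫ r in (0 : ℝ)..1, trace (P.T r * (P.E r).fc (weight fun x => ((deriv ψ x : ℝ) : ℂ))) := by
  obtain ⟨c, hc1, hc2, hs, hs'⟩ := exists_cayley_series hψ hc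
  obtain ⟨K, hK⟩ := P.exists_traceBound_U_sub
  obtain ⟨K', hK0', hK'⟩ := P.exists_norm_trace_le
  have hdc : Continuous (deriv ψ) := hψ.continuous_deriv (by norm_cast)
  have hψb := bddMeas_ofReal hψ.continuous hc
  have hwb : BddMeas (weight fun x => ((deriv ψ x : ℝ) : ℂ)) :=
    (bddMeas_ofReal hdc hc.deriv).weight (hasCompactSupport_ofReal hc.deriv)
  have hfc : ∀ r, HasSum (fun n => c n • P.U n r) ((P.E r).fcR ψ) := by
    intro r
    have h := (P.E r).hasSum_fc hc1 (fun n => ((bddMeas_cayley_zpow n).const_mul (c n)).1)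
      (fun n x => by rw [norm_mul, norm_zpow, norm_cayley, one_zpow, mul_one]) hψb hs
    simp only [(P.E r).fc_const_mul (bddMeas_cayley_zpow _)] at h
    exact h
  have hcoef : ∀ n : ℤ, ‖c n * (-2 * I * n)‖ = 2 * (|(n : ℝ)| * ‖c n‖) := by
    intro n
    simp only [norm_mul, norm_neg, Complex.norm_ofNat, Complex.norm_I, Complex.norm_intCast]
    ring
  have hsum2 : Summable fun n : ℤ => ‖c n * (-2 * I * n)‖ := by
    simp only [hcoef]
    exact hc2.mul_left 2
  have hfc' : ∀ r, HasSum (fun n : ℤ => (c n * (-2 * I * n)) • P.U (n - 1) r)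
      ((P.E r).fc (weight fun x => ((deriv ψ x : ℝ) : ℂ))) := by
    intro r
    have h := (P.E r).hasSum_fc hsum2
      (fun n => ((bddMeas_cayley_zpow (n - 1)).const_mul (c n * (-2 * I * n))).1)
      (fun n x => by rw [norm_mul, norm_zpow, norm_cayley, one_zpow, mul_one]) hwb hs'
    simp only [(P.E r).fc_const_mul (bddMeas_cayley_zpow _)] at h
    exact h
  have hdiff : HasSum (fun n => c n • (P.U n 1 - P.U n 0)) ((P.E 1).fcR ψ - (P.E 0).fcR ψ) := by
    simpa only [smul_sub] using (hfc 1).sub (hfc 0)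
  have htb : ∀ n, TraceBound (c n • (P.U n 1 - P.U n 0)) (‖c n‖ * (K * |(n : ℝ)|)) :=
    fun n => (hK n).smul (c n)
  have htbs : Summable fun n : ℤ => ‖c n‖ * (K * |(n : ℝ)|) :=
    (hc2.mul_left K).congr fun n => by ring
  have htr := hasSum_trace htb htbs hdiff
  have hterm : ∀ r, HasSum (fun n : ℤ => c n * (-2 * I * n * trace (P.T r * P.U (n - 1) r)))
      (trace (P.T r * (P.E r).fc (weight fun x => ((deriv ψ x : ℝ) : ℂ)))) := by
    intro r
    have hTr : IsTraceClass (P.T r) := by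
      rw [T, sandwich_eq]
      exact (P.isTraceClass_T_zero.mul_left _).mul_right _
    have h := (hfc' r).mapL (traceMul hTr)
    simp only [map_smul, smul_eq_mul, traceMul_apply] at h
    simpa only [mul_assoc] using h
  have hbd : ∀ n : ℤ, ∀ r ∈ Icc (0 : ℝ) 1,
      ‖c n * (-2 * I * n * trace (P.T r * P.U (n - 1) r))‖ ≤ ‖c n * (-2 * I * n)‖ * K' := by
    intro n r hr
    rw [← mul_assoc, norm_mul]
    gcongr
    refine (hK' r hr _).trans ?_
    exact mul_le_of_le_one_right hK0' (P.norm_U_le _ _)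
  refine ⟨(TraceBound.of_hasSum htb htbs hdiff).isTraceClass, ?_, ?_⟩
  · have h := continuousOn_tsum (s := Icc (0 : ℝ) 1)
      (f := fun (n : ℤ) r => c n * (-2 * I * n * trace (P.T r * P.U (n - 1) r)))
      (fun n => (continuous_const.mul
        (continuous_const.mul (P.continuous_trace_T_mul_U (n - 1)))).continuousOn)
      (hsum2.mul_right K') hbd
    exact h.congr fun r _ => (hterm r).tsum_eq.symm
  · have h := intervalIntegral.hasSum_integral_of_dominated_convergence (μ := volume) (a := 0) (b := 1)
      (F := fun (n : ℤ) r => c n * (-2 * I * n * trace (P.T r * P.U (n - 1) r)))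
      (fun n _ => ‖c n * (-2 * I * n)‖ * K')
      (fun n => (continuous_const.mul
        (continuous_const.mul (P.continuous_trace_T_mul_U (n - 1)))).aestronglyMeasurable)
      (fun n => Eventually.of_forall fun r hr => hbd n r (by
        rw [uIoc_of_le zero_le_one] at hr; exact ⟨hr.1.le, hr.2⟩))
      (Eventually.of_forall fun r _ => hsum2.mul_right K')
      intervalIntegrable_const
      (Eventually.of_forall fun r _ => hterm r)
    refine htr.unique ?_
    have hn : ∀ n : ℤ, trace (c n • (P.U n 1 - P.U n 0)) =
        ∫ r in (0 : ℝ)..1, c n * (-2 * I * n * trace (P.T r * P.U (n - 1) r)) := fun n => by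
      rw [trace_smul, trace_U_sub, ← intervalIntegral.integral_const_mul]
    simpa only [hn] using h

lemma isTraceClass_T (r : ℝ) : IsTraceClass (P.T r) := by
  rw [T, sandwich_eq]
  exact (P.isTraceClass_T_zero.mul_left _).mul_right _

lemma fc_eq_R_mul_R_mul {g : ℝ → ℂ} (hg : BddMeas g) (hc : HasCompactSupport g) (r : ℝ) :
    (P.E r).fc g = P.R r * (P.R r * (P.E r).fc (weight g)) := by
  have hb : BddMeas fun x : ℝ => ((x : ℂ) - (-I))⁻¹ :=
    SpectralMeasure.bddMeas_resolvent (by simp)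
  rw [R_eq_fc, ← (P.E r).fc_mul hb (hg.weight hc), ← (P.E r).fc_mul hb (hb.mul (hg.weight hc))]
  congr 1
  ext x
  have := ofReal_sub_neg_I_ne_zero x
  unfold weight
  field_simp

lemma trace_proj_mul {g : ℝ → ℂ} (hg : BddMeas g) (hc : HasCompactSupport g) (r : ℝ) :
    trace ((P.E r).proj (tsupport g) * (P.V * (P.E r).fc g))
      = trace (P.T r * (P.E r).fc (weight g)) := by
  set K := tsupport g with hK
  have hKm : MeasurableSet K := (isClosed_tsupport g).measurableSet
  have hKc : HasCompactSupport (K.indicator fun _ => (1 : ℂ)) :=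
    HasCompactSupport.intro hc.isCompact fun x hx => indicator_of_notMem hx _
  have ha : BddMeas fun x : ℝ => K.indicator (fun _ => (1 : ℂ)) x * ((x : ℂ) - (-I)) :=
    (BddMeas.indicator hKm).mul_continuous hKc (by fun_prop)
  have hb : BddMeas fun x : ℝ => ((x : ℂ) - (-I))⁻¹ :=
    SpectralMeasure.bddMeas_resolvent (by simp)
  have hw := hg.weight hc
  have h1 : (P.E r).proj K =
      (P.E r).fc (fun x : ℝ => K.indicator (fun _ => (1 : ℂ)) x * ((x : ℂ) - (-I))) * P.R r := by
    rw [← (P.E r).fc_indicator hKm, R_eq_fc, ← (P.E r).fc_mul ha hb]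
    congr 1
    ext x
    rw [mul_assoc, mul_inv_cancel₀ (ofReal_sub_neg_I_ne_zero x), mul_one]
  have h2 : P.R r * ((P.E r).fc (weight g) *
      (P.E r).fc (fun x : ℝ => K.indicator (fun _ => (1 : ℂ)) x * ((x : ℂ) - (-I))))
      = (P.E r).fc (weight g) := by
    rw [R_eq_fc, ← (P.E r).fc_mul hw ha, ← (P.E r).fc_mul hb (hw.mul ha)]
    congr 1
    ext x
    by_cases hx : x ∈ K
    · have := ofReal_sub_neg_I_ne_zero x
      rw [indicator_of_mem hx]
      field_simp
    · rw [weight, image_eq_zero_of_notMem_tsupport hx]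
      simp
  rw [h1, P.fc_eq_R_mul_R_mul hg hc]
  have h3 : ∀ a : 𝓗 →L[ℂ] 𝓗, a * P.R r * (P.V * (P.R r * (P.R r * (P.E r).fc (weight g))))
      = a * (P.T r * (P.R r * (P.E r).fc (weight g))) := fun a => by
    rw [T]; simp only [mul_assoc]
  rw [h3, trace_mul_comm ((P.isTraceClass_T r).mul_right _), mul_assoc, mul_assoc, h2]

end TracePath

namespace SpectralMeasure

variable {H H' : SelfAdjointOperator 𝓗}

lemma star_resolvent (E : SpectralMeasure H) {z : ℂ} (hz : z.im ≠ 0) :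
    star (H.resolvent ((starRingEnd ℂ) z)) = H.resolvent z := by
  have hz' : ((starRingEnd ℂ) z).im ≠ 0 := by simpa using hz
  rw [← E.fc_resolvent hz', ← E.fc_resolvent hz, ← E.fc_conj (bddMeas_resolvent hz')]
  simp

lemma isSelfAdjoint_fcR (E : SpectralMeasure H) {ψ : ℝ → ℝ} (hψ : BddMeas fun x => (ψ x : ℂ)) :
    IsSelfAdjoint (E.fcR ψ) := by
  rw [isSelfAdjoint_iff, fcR, ← E.fc_conj hψ]
  simp

/-- If the resolvent at `-i` of `H'` is the one of `φ(H)`, then `ψ(H') = (ψ ∘ φ)(H)`. -/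
lemma fcR_eq_of_resolvent (E : SpectralMeasure H) (E' : SpectralMeasure H') {φ : ℝ → ℝ}
    (hφ : Measurable φ) (h : H'.resolvent (-I) = E.fc fun x => ((φ x : ℂ) - (-I))⁻¹)
    {ψ : ℝ → ℝ} (hψ : ContDiff ℝ (⊤ : ℕ∞) ψ) (hc : HasCompactSupport ψ) :
    E'.fcR ψ = E.fcR fun x => ψ (φ x) := by
  have hb : BddMeas fun x : ℝ => ((x : ℂ) - (-I))⁻¹ := bddMeas_resolvent (by simp)
  have hcay : ∀ n : ℤ, E'.fc (fun x => cayley x ^ n) = E.fc fun x => cayley (φ x) ^ n := by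
    have h1 : E'.fc (fun x => cayley x) = E.fc fun x => cayley (φ x) := by
      unfold cayley
      rw [E'.fc_add (.const (-1)) (hb.const_mul _), E'.fc_const_mul hb, E'.fc_resolvent (by simp), h,
        E.fc_add (.const (-1)) ((hb.comp hφ).const_mul _), E.fc_const_mul (hb.comp hφ)]
      have h2 := E.fc_const_mul (.const 1) (-1)
      have h3 := E'.fc_const_mul (.const 1) (-1)
      simp only [mul_one] at h2 h3
      rw [h2, h3, E.fc_one, E'.fc_one]
    have hn : ∀ n : ℕ, E'.fc (fun x => cayley x ^ (n : ℤ)) = E.fc fun x => cayley (φ x) ^ (n : ℤ) := by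
      intro n
      induction n with
      | zero => simp only [Nat.cast_zero, zpow_zero, fc_one]
      | succ n ih =>
        have hc1 : BddMeas cayley := by simpa using bddMeas_cayley_zpow 1
        simp only [Nat.cast_succ, zpow_add_one₀ (cayley_ne_zero _)]
        rw [E'.fc_mul (bddMeas_cayley_zpow n) hc1,
          E.fc_mul ((bddMeas_cayley_zpow n).comp hφ) (hc1.comp hφ), ih]
        exact congrArg _ h1
    intro n
    obtain ⟨m, rfl | rfl⟩ := n.eq_nat_or_neg
    · exact hn m
    · have hconj : ∀ x, cayley x ^ (-(m : ℤ)) = (starRingEnd ℂ) (cayley x ^ (m : ℤ)) := fun x => by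
        rw [map_zpow₀, zpow_neg, ← inv_zpow, Complex.inv_eq_conj (norm_cayley x)]
      simp only [hconj]
      rw [E'.fc_conj (bddMeas_cayley_zpow m), E.fc_conj ((bddMeas_cayley_zpow m).comp hφ), hn]
  obtain ⟨c, hc1, -, hs, -⟩ := exists_cayley_series hψ hc
  have hψb := bddMeas_ofReal hψ.continuous hc
  have s1 := E'.hasSum_fc hc1 (fun n => ((bddMeas_cayley_zpow n).const_mul (c n)).1)
      (fun n x => by rw [norm_mul, norm_zpow, norm_cayley, one_zpow, mul_one]) hψb hs
  have s2 := E.hasSum_fc hc1 (fun n => (((bddMeas_cayley_zpow n).comp hφ).const_mul (c n)).1)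
      (fun n x => by rw [norm_mul, norm_zpow, norm_cayley, one_zpow, mul_one]) (hψb.comp hφ)
      (fun x => hs (φ x))
  simp only [E'.fc_const_mul (bddMeas_cayley_zpow _)] at s1
  simp only [E.fc_const_mul ((bddMeas_cayley_zpow _).comp hφ), ← hcay] at s2
  exact s1.unique s2

/-- A left inverse of `φ(H) + i` is `(φ + i)⁻¹(H)`. -/
lemma eq_fc_of_mul_eq_one (E : SpectralMeasure H) {φ : ℝ → ℝ} (hφ : BddMeas fun x => (φ x : ℂ))
    (hφm : Measurable φ) {R : 𝓗 →L[ℂ] 𝓗} (h : R * (E.fcR φ + I • 1) = 1) :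
    R = E.fc fun x => ((φ x : ℂ) - (-I))⁻¹ := by
  have hb : BddMeas fun x : ℝ => ((φ x : ℂ) - (-I))⁻¹ :=
    (bddMeas_resolvent (z := -I) (by simp)).comp hφm
  have h1 : E.fcR φ + I • 1 = E.fc fun x => (φ x : ℂ) + I * 1 := by
    rw [E.fc_add hφ ((BddMeas.const 1).const_mul I), E.fc_const_mul (.const 1), E.fc_one]
    rfl
  have h2 : (E.fcR φ + I • 1) * E.fc (fun x => ((φ x : ℂ) - (-I))⁻¹) = 1 := by
    rw [h1, ← E.fc_mul (hφ.add ((BddMeas.const 1).const_mul I)) hb, ← E.fc_one]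
    congr 1
    ext x
    rw [mul_one, ← sub_neg_eq_add, mul_inv_cancel₀ (ofReal_sub_neg_I_ne_zero _)]
  rw [← mul_one R, ← h2, ← mul_assoc, h, one_mul]

end SpectralMeasure

section IsSum

variable {H₀ H₁ H₂ : SelfAdjointOperator 𝓗} {V W : 𝓗 →L[ℂ] 𝓗} {z : ℂ}

lemma IsSum.sub_eq (h : IsSum H₀ V H₁) (hz : z.im ≠ 0) :
    H₁.resolvent z - H₀.resolvent z = -(H₁.resolvent z * V * H₀.resolvent z) := h z hz

lemma IsSum.sub_eq_left (E₀ : SpectralMeasure H₀) (E₁ : SpectralMeasure H₁) (hV : IsSelfAdjoint V)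
    (h : IsSum H₀ V H₁) (hz : z.im ≠ 0) :
    H₁.resolvent z - H₀.resolvent z = -(H₀.resolvent z * V * H₁.resolvent z) := by
  have hz' : ((starRingEnd ℂ) z).im ≠ 0 := by simpa using hz
  have h1 := congrArg star (h.sub_eq hz')
  rwa [star_sub, star_neg, star_mul, star_mul, E₀.star_resolvent hz, E₁.star_resolvent hz,
    hV.star_eq, ← mul_assoc] at h1

lemma IsSum.resolvent_sub (E₀ : SpectralMeasure H₀) (E₂ : SpectralMeasure H₂)
    (hW : IsSelfAdjoint W) (h₁ : IsSum H₀ V H₁) (h₂ : IsSum H₀ W H₂) (hz : z.im ≠ 0) :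
    H₁.resolvent z - H₂.resolvent z = -(H₁.resolvent z * (V - W) * H₂.resolvent z) := by
  have e1 := h₁.sub_eq hz
  have e2 := h₂.sub_eq_left E₀ E₂ hW hz
  generalize H₁.resolvent z = A at *
  generalize H₂.resolvent z = B at *
  generalize H₀.resolvent z = C at *
  have e3 : A * V * C = C - A := by rw [← neg_sub, e1, neg_neg]
  have e4 : B = C - C * W * B := by rw [sub_eq_add_neg, ← e2]; abel
  have e5 : A * V * B = C - A - (C - A) * W * B := by
    conv_lhs => rw [e4]
    rw [mul_sub, e3, ← mul_assoc, ← mul_assoc, e3]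
  rw [mul_sub, sub_mul, e5, sub_mul, sub_mul]
  nth_rewrite 1 [e4]
  abel

end IsSum

/-- The straight line path between two operators of an affine setting. -/
def AffineSetting.path (𝒜 : AffineSetting 𝓗) (E : ∀ V : 𝓗 →L[ℂ] 𝓗, SpectralMeasure (𝒜.opOf V))
    {W₀ W₁ : 𝓗 →L[ℂ] 𝓗} (hW₀ : W₀ ∈ 𝒜.A0) (hW₁ : W₁ ∈ 𝒜.A0) : TracePath 𝓗 where
  H r := 𝒜.opOf (W₀ + (r : ℂ) • (W₁ - W₀))
  E r := E (W₀ + (r : ℂ) • (W₁ - W₀))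
  V := W₁ - W₀
  resolvent_sub := by
    have hmem : ∀ r : ℝ, W₀ + (r : ℂ) • (W₁ - W₀) ∈ 𝒜.A0 := fun r =>
      𝒜.add_mem hW₀ (𝒜.smul_mem r (by rw [sub_eq_add_neg]; exact 𝒜.add_mem hW₁ (𝒜.neg_mem hW₀)))
    intro r s
    rw [IsSum.resolvent_sub (E 0) (E _) (𝒜.sa_mem _ (hmem s)) (𝒜.opOf_spec _ (hmem r))
      (𝒜.opOf_spec _ (hmem s)) (by simp), add_sub_add_left_eq_sub, ← sub_smul, mul_smul_comm,
      smul_mul_assoc, ← neg_smul, neg_sub]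
  isTraceClass := by
    obtain ⟨z, hz, hcomp⟩ := 𝒜.comparable W₀ hW₀ W₁ hW₁
    have e1 := IsSum.resolvent_sub (E 0) (E _) (𝒜.sa_mem _ hW₀) (𝒜.opOf_spec _ hW₁)
      (𝒜.opOf_spec _ hW₀) hz
    have e2 := IsSum.resolvent_sub (E 0) (E _) (𝒜.sa_mem _ hW₁) (𝒜.opOf_spec _ hW₀)
      (𝒜.opOf_spec _ hW₁) hz
    have h0 : W₀ + ((0 : ℝ) : ℂ) • (W₁ - W₀) = W₀ := by simp
    rw [h0]
    have ht : IsTraceClass ((𝒜.opOf W₀).resolvent z * (W₁ - W₀) * (𝒜.opOf W₀).resolvent z) := by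
      have t1 : IsTraceClass ((𝒜.opOf W₁).resolvent z * (W₁ - W₀) * (𝒜.opOf W₀).resolvent z) := by
        rw [← neg_neg (_ * _ * _), ← e1]
        exact hcomp.neg
      have e3 : (𝒜.opOf W₀).resolvent z = (1 + (𝒜.opOf W₀).resolvent z * (W₁ - W₀)) *
          (𝒜.opOf W₁).resolvent z := by
        rw [add_mul, one_mul, ← sub_eq_iff_eq_add', e2, ← neg_mul, ← mul_neg, neg_sub]
      have e4 : (𝒜.opOf W₀).resolvent z * (W₁ - W₀) * (𝒜.opOf W₀).resolvent z =
          (1 + (𝒜.opOf W₀).resolvent z * (W₁ - W₀)) *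
          ((𝒜.opOf W₁).resolvent z * (W₁ - W₀) * (𝒜.opOf W₀).resolvent z) := by
        conv_lhs => enter [1, 1]; rw [e3]
        simp only [mul_assoc]
      rw [e4]
      exact t1.mul_left _
    have hI : (-I).im ≠ 0 := by simp
    have hb := SpectralMeasure.bddMeas_resolvent hI
    have hbz := SpectralMeasure.bddMeas_resolvent hz
    have hq : BddMeas fun x : ℝ => ((x : ℂ) - z) * ((x : ℂ) - (-I))⁻¹ := by
      have := (BddMeas.const 1).add (hb.const_mul (-I - z))
      convert this using 2 with x
      have := ofReal_sub_neg_I_ne_zero x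
      field_simp
      ring
    have q1 : (𝒜.opOf W₀).resolvent (-I) =
        (E W₀).fc (fun x : ℝ => ((x : ℂ) - z) * ((x : ℂ) - (-I))⁻¹) * (𝒜.opOf W₀).resolvent z := by
      rw [← (E W₀).fc_resolvent hI, ← (E W₀).fc_resolvent hz, ← (E W₀).fc_mul hq hbz]
      congr 1
      ext x
      rw [mul_right_comm, mul_inv_cancel₀ (ofReal_sub_ne_zero x hz), one_mul]
    have q2 : (𝒜.opOf W₀).resolvent (-I) = (𝒜.opOf W₀).resolvent z *
        (E W₀).fc (fun x : ℝ => ((x : ℂ) - z) * ((x : ℂ) - (-I))⁻¹) := by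
      rw [← (E W₀).fc_resolvent hI, ← (E W₀).fc_resolvent hz, ← (E W₀).fc_mul hbz hq]
      congr 1
      ext x
      rw [← mul_assoc, inv_mul_cancel₀ (ofReal_sub_ne_zero x hz), one_mul]
    have e5 : (𝒜.opOf W₀).resolvent (-I) * (W₁ - W₀) * (𝒜.opOf W₀).resolvent (-I) =
        (E W₀).fc (fun x : ℝ => ((x : ℂ) - z) * ((x : ℂ) - (-I))⁻¹) *
        ((𝒜.opOf W₀).resolvent z * (W₁ - W₀) * (𝒜.opOf W₀).resolvent z) *
        (E W₀).fc (fun x : ℝ => ((x : ℂ) - z) * ((x : ℂ) - (-I))⁻¹) := by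
      conv_lhs => rw [mul_assoc, q1]
      conv_lhs => enter [2]; rw [← q1, q2]
      simp only [mul_assoc]
    rw [e5]
    exact (ht.mul_left _).mul_right _

/-- The straight line path attached to a trace class perturbation. -/
def TracePath.ofTraceClass {B : ℝ → SelfAdjointOperator 𝓗} (EB : ∀ r, SpectralMeasure (B r))
    {D : 𝓗 →L[ℂ] 𝓗} (hD : IsTraceClass D) (hsa : IsSelfAdjoint D)
    (hB : ∀ r : ℝ, IsSum (B 0) ((r : ℂ) • D) (B r)) : TracePath 𝓗 where
  H := B
  E := EB
  V := D
  resolvent_sub := by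
    intro r s
    have hs : IsSelfAdjoint ((s : ℂ) • D) := by
      rw [isSelfAdjoint_iff, star_smul, hsa.star_eq]
      simp
    rw [IsSum.resolvent_sub (EB 0) (EB s) hs (hB r) (hB s) (by simp), ← sub_smul, mul_smul_comm,
      smul_mul_assoc, ← neg_smul, neg_sub]
  isTraceClass := (hD.mul_left _).mul_right _

lemma IsBoundedSAOpOf.resolvent_mul {A : SelfAdjointOperator 𝓗} {T : 𝓗 →L[ℂ] 𝓗}
    (h : IsBoundedSAOpOf A T) : A.resolvent (-I) * (T + I • 1) = 1 := by
  ext x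
  have hx : x ∈ A.domain := by rw [h.1]; trivial
  have h1 := A.resolvent_left (-I) (by simp) ⟨x, hx⟩
  rw [h.2] at h1
  simpa using h1

lemma IsSum.resolvent_mul {H₀ H₁ : SelfAdjointOperator 𝓗} {T D : 𝓗 →L[ℂ] 𝓗} (h : IsSum H₀ D H₁)
    (hT : H₀.resolvent (-I) * (T + I • 1) = 1) : H₁.resolvent (-I) * (T + D + I • 1) = 1 := by
  have h1 := congrArg (· * (T + I • 1)) (h.sub_eq (z := -I) (by simp))
  simp only [sub_mul, neg_mul, hT, mul_assoc, mul_one] at h1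
  rw [add_right_comm, mul_add, ← sub_eq_zero, ← sub_eq_zero.2 h1]
  abel

lemma induction_smooth {p : (ℝ → ℂ) → Prop}
    (hderiv : ∀ ψ : ℝ → ℝ, ContDiff ℝ (⊤ : ℕ∞) ψ → HasCompactSupport ψ →
      p fun x => ((deriv ψ x : ℝ) : ℂ))
    (hlim : ∀ (f : ℕ → ℝ → ℂ) (F : ℝ → ℂ) (C : ℝ), (∀ n, Measurable (f n)) →
      (∀ n x, ‖f n x‖ ≤ C) → (∀ x, Tendsto (fun n => f n x) atTop (𝓝 (F x))) →
      (∀ n, p (f n)) → p F)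
    {f : ℝ → ℝ} (hf : ContDiff ℝ (⊤ : ℕ∞) f) (hc : HasCompactSupport f) :
    p fun x => (f x : ℂ) := by
  let ρ : ContDiffBump (0 : ℝ) := ⟨1, 2, one_pos, one_lt_two⟩
  have hρ : ContDiff ℝ (⊤ : ℕ∞) (ρ.normed volume) := ρ.contDiff_normed
  have hρc : HasCompactSupport (ρ.normed volume) := ρ.hasCompactSupport_normed
  obtain ⟨M, hM⟩ := hc.exists_bound_of_continuous hf.continuous
  obtain ⟨N, hN⟩ := hρc.exists_bound_of_continuous hρ.continuous
  have hM0 := (norm_nonneg _).trans (hM 0)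
  have hN0 := (norm_nonneg _).trans (hN 0)
  set m := ∫ x, f x with hm
  let a : ℕ → ℝ := fun n => ((n : ℝ) + 1)⁻¹
  have ha : ∀ n, 0 < a n := fun n => by positivity
  have ha1 : ∀ n, a n ≤ 1 := fun n => inv_le_one_of_one_le₀ (by simp)
  have ha0 : Tendsto a atTop (𝓝 0) := by
    simpa [a] using tendsto_one_div_add_atTop_nhds_zero_nat (𝕜 := ℝ)
  let g : ℕ → ℝ → ℝ := fun n x => f x - m * (a n * ρ.normed volume (a n * x))
  have hg : ∀ n, ContDiff ℝ (⊤ : ℕ∞) (g n) := fun n =>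
    hf.sub (contDiff_const.mul (contDiff_const.mul (hρ.comp (contDiff_const.mul contDiff_id))))
  have hgc : ∀ n, HasCompactSupport (g n) := fun n => by
    have h1 : HasCompactSupport fun x => ρ.normed volume (a n * x) :=
      hρc.comp_homeomorph (Homeomorph.mulLeft₀ (a n) (ha n).ne')
    exact hc.sub (h1.mul_left.mul_left)
  have hgi : ∀ n, ∫ x, g n x = 0 := fun n => by
    have h1 : Integrable fun x => m * (a n * ρ.normed volume (a n * x)) :=
      (((ρ.integrable_normed (μ := volume)).comp_mul_left' (ha n).ne').const_mul _).const_mul _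
    rw [integral_sub (hf.continuous.integrable_of_hasCompactSupport hc) h1, integral_const_mul,
      integral_const_mul, Measure.integral_comp_mul_left, ρ.integral_normed, abs_of_pos (inv_pos.2 (ha n))]
    simp [(ha n).ne', hm]
  refine hlim (fun n x => (g n x : ℂ)) _ (M + |m| * (1 * N)) (fun n => ?_) (fun n x => ?_)
    (fun x => ?_) fun n => ?_
  · exact Complex.measurable_ofReal.comp (hg n).continuous.measurable
  · rw [Complex.norm_real]
    refine (norm_sub_le _ _).trans (add_le_add (hM x) ?_)
    rw [norm_mul, norm_mul, Real.norm_eq_abs, Real.norm_eq_abs, abs_of_pos (ha n)]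
    gcongr
    · exact ha1 n
    · exact hN _
  · refine (Complex.continuous_ofReal.tendsto _).comp ?_
    have h1 : Tendsto (fun n => a n * ρ.normed volume (a n * x)) atTop (𝓝 0) := by
      refine squeeze_zero_norm (a := fun n => a n * N) (fun n => ?_) (by simpa using ha0.mul_const N)
      rw [norm_mul, Real.norm_eq_abs, abs_of_pos (ha n)]
      exact mul_le_mul_of_nonneg_left (hN _) (ha n).le
    simpa [g] using (tendsto_const_nhds (x := f x)).sub (h1.const_mul m)
  · obtain ⟨R, hR⟩ : ∃ R, ∀ x, R ≤ |x| → g n x = 0 := by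
      obtain ⟨R, hR⟩ := (hgc n).isCompact.isBounded.subset_closedBall (0 : ℝ)
      refine ⟨R + 1, fun x hx => image_eq_zero_of_notMem_tsupport fun hx' => ?_⟩
      have := hR hx'
      rw [mem_closedBall_zero_iff, Real.norm_eq_abs] at this
      linarith
    have hgint : Integrable (g n) := (hg n).continuous.integrable_of_hasCompactSupport (hgc n)
    have hd : ∀ x, HasDerivAt (fun x => ∫ t in Iic x, g n t) (g n x) x := fun x => by
      have h1 : ∀ y, ∫ t in Iic y, g n t = (∫ t in Iic x, g n t) + ∫ t in x..y, g n t := fun y => by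
        rw [← intervalIntegral.integral_Iic_sub_Iic hgint.integrableOn hgint.integrableOn]; abel
      rw [funext h1]
      exact (intervalIntegral.integral_hasDerivAt_right hgint.intervalIntegrable
        ((hg n).continuous.stronglyMeasurableAtFilter _ _) (hg n).continuous.continuousAt).const_add _
    have hde : deriv (fun x => ∫ t in Iic x, g n t) = g n := funext fun x => (hd x).deriv
    have hp := hderiv (fun x => ∫ t in Iic x, g n t)
      (contDiff_infty_iff_deriv.2 ⟨fun x => (hd x).differentiableAt, by rw [hde]; exact hg n⟩) ?_
    · rwa [hde] at hp
    · refine HasCompactSupport.intro (isCompact_Icc (a := -R) (b := R)) fun x hx => ?_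
      rw [mem_Icc, not_and_or, not_le, not_le] at hx
      rcases hx with hx | hx
      · refine setIntegral_eq_zero_of_forall_eq_zero fun t ht => hR t ?_
        exact le_trans (by linarith [mem_Iic.1 ht]) (neg_le_abs t)
      · rw [← hgi n, ← integral_add_compl measurableSet_Iic hgint (s := Iic x), left_eq_add, compl_Iic]
        refine setIntegral_eq_zero_of_forall_eq_zero fun t ht => hR t ?_
        exact le_trans (by linarith [mem_Ioi.1 ht]) (le_abs_self t)

/-- A property which holds for derivatives of test functions and is stable under linear
combinations and bounded pointwise limits holds for all bounded measurable functions. -/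
lemma BddMeas.induction_deriv {p : (ℝ → ℂ) → Prop}
    (hderiv : ∀ ψ : ℝ → ℝ, ContDiff ℝ (⊤ : ℕ∞) ψ → HasCompactSupport ψ →
      p fun x => ((deriv ψ x : ℝ) : ℂ))
    (hadd : ∀ f g, BddMeas f → BddMeas g → p f → p g → p fun x => f x + g x)
    (hmul : ∀ (c : ℂ) f, BddMeas f → p f → p fun x => c * f x)
    (hlim : ∀ (f : ℕ → ℝ → ℂ) (F : ℝ → ℂ) (C : ℝ), (∀ n, Measurable (f n)) →
      (∀ n x, ‖f n x‖ ≤ C) → (∀ x, Tendsto (fun n => f n x) atTop (𝓝 (F x))) →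
      (∀ n, p (f n)) → p F)
    {g : ℝ → ℂ} (hg : BddMeas g) : p g := by
  have hind1 : ∀ (s : Set ℝ) x, ‖s.indicator (fun _ => (1 : ℂ)) x‖ ≤ 1 := fun s x => by
    by_cases hx : x ∈ s <;> simp [hx]
  have hIoo : ∀ a b : ℝ, p ((Ioo a b).indicator fun _ => 1) := by
    intro a b
    have hlimS : ∀ y : ℝ, Tendsto (fun n : ℕ => Real.smoothTransition (n * y)) atTop
        (𝓝 ((Ioi (0 : ℝ)).indicator (fun _ => 1) y)) := by
      intro y
      by_cases hy : 0 < y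
      · rw [indicator_of_mem (mem_Ioi.2 hy)]
        refine tendsto_const_nhds.congr' ?_
        filter_upwards [(tendsto_natCast_atTop_atTop.atTop_mul_const hy).eventually_ge_atTop 1]
          with n hn
        exact (Real.smoothTransition.one_of_one_le hn).symm
      · rw [indicator_of_notMem (by simpa using hy)]
        refine tendsto_const_nhds.congr fun n => ?_
        exact (Real.smoothTransition.zero_of_nonpos
          (mul_nonpos_of_nonneg_of_nonpos n.cast_nonneg (not_lt.1 hy))).symm
    let u : ℕ → ℝ → ℝ := fun n x =>
      Real.smoothTransition (n * (x - a)) * Real.smoothTransition (n * (b - x))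
    have hu : ∀ n, ContDiff ℝ (⊤ : ℕ∞) (u n) := fun n =>
      (Real.smoothTransition.contDiff.comp (contDiff_const.mul (contDiff_id.sub contDiff_const))).mul
        (Real.smoothTransition.contDiff.comp (contDiff_const.mul (contDiff_const.sub contDiff_id)))
    refine hlim (fun n x => (u n x : ℂ)) _ 1
      (fun n => Complex.measurable_ofReal.comp (hu n).continuous.measurable) (fun n x => ?_)
      (fun x => ?_) (fun n => induction_smooth hderiv hlim (hu n) ?_)
    · rw [Complex.norm_real, norm_mul, Real.norm_of_nonneg (Real.smoothTransition.nonneg _),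
        Real.norm_of_nonneg (Real.smoothTransition.nonneg _)]
      exact mul_le_one₀ (Real.smoothTransition.le_one _) (Real.smoothTransition.nonneg _)
        (Real.smoothTransition.le_one _)
    · have h1 := (Complex.continuous_ofReal.tendsto _).comp ((hlimS (x - a)).mul (hlimS (b - x)))
      have h4 : (Ioo a b).indicator (fun _ => (1 : ℂ)) x = (((Ioi (0 : ℝ)).indicator (fun _ => 1)
          (x - a) * (Ioi (0 : ℝ)).indicator (fun _ => 1) (b - x) : ℝ) : ℂ) := by
        by_cases h2 : a < x <;> by_cases h3 : x < b <;> simp [h2, h3]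
      rw [h4]
      exact h1
    · refine HasCompactSupport.intro (isCompact_Icc (a := a) (b := b)) fun x hx => ?_
      rw [mem_Icc, not_and_or, not_le, not_le] at hx
      rcases hx with hx | hx
      · simp only [u]
        rw [Real.smoothTransition.zero_of_nonpos, zero_mul]
        exact mul_nonpos_of_nonneg_of_nonpos n.cast_nonneg (by linarith)
      · simp only [u]
        rw [mul_comm, Real.smoothTransition.zero_of_nonpos, zero_mul]
        exact mul_nonpos_of_nonneg_of_nonpos n.cast_nonneg (by linarith)
  have hone : p fun _ => 1 := by
    refine hlim (fun n => (Ioo (-(n : ℝ)) n).indicator fun _ => 1) _ 1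
      (fun n => measurable_const.indicator measurableSet_Ioo) (fun n => hind1 _) (fun x => ?_)
      fun n => hIoo _ _
    refine tendsto_const_nhds.congr' ?_
    filter_upwards [tendsto_natCast_atTop_atTop.eventually_gt_atTop |x|] with n hn
    rw [indicator_of_mem (mem_Ioo.2 (abs_lt.1 hn))]
  have hzero : p fun _ => 0 := by simpa using hmul 0 _ (.const 1) hone
  refine hg.induction (p := p) (fun s hs => ?_) hadd hmul hlim
  refine MeasurableSpace.induction_on_inter
    (C := fun s _ => p (s.indicator fun _ => 1))
    ((BorelSpace.measurable_eq (α := ℝ)).trans Real.borel_eq_generateFrom_Ioo_rat)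
    Real.isPiSystem_Ioo_rat ?_ ?_ ?_ ?_ s hs
  · simpa using hzero
  · intro t ht
    simp only [mem_iUnion, mem_singleton_iff] at ht
    obtain ⟨a, b, -, rfl⟩ := ht
    exact hIoo a b
  · intro t ht h
    have h1 := hadd _ _ (.const 1) ((BddMeas.indicator ht).const_mul (-1)) hone
      (hmul (-1) _ (.indicator ht) h)
    convert h1 using 2 with x
    by_cases hx : x ∈ t <;> simp [hx]
  · intro t hd ht h
    have hpart : ∀ n : ℕ, p ((⋃ i ∈ Finset.range n, t i).indicator fun _ => 1) := by
      intro n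
      induction n with
      | zero => simpa using hzero
      | succ n ih =>
        have h1 := hadd _ _ (BddMeas.indicator (Finset.measurableSet_biUnion _ fun i _ => ht i))
          (.indicator (ht n)) ih (h n)
        convert h1 using 2 with x
        rw [Finset.range_add_one, Finset.set_biUnion_insert, union_comm,
          indicator_union_of_disjoint]
        refine disjoint_iUnion₂_left.2 fun i hi => hd (Finset.mem_range.1 hi).ne
    refine hlim _ _ 1 (fun n => measurable_const.indicator
      (Finset.measurableSet_biUnion _ fun i _ => ht i)) (fun n => hind1 _) (fun x => ?_) hpart
    refine tendsto_const_nhds.congr' ?_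
    by_cases hx : x ∈ ⋃ i, t i
    · obtain ⟨i, hi⟩ := mem_iUnion.1 hx
      filter_upwards [eventually_gt_atTop i] with n hn
      rw [indicator_of_mem hx, indicator_of_mem]
      exact mem_biUnion (Finset.mem_coe.2 (Finset.mem_range.2 hn)) hi
    · filter_upwards with n
      rw [indicator_of_notMem hx, indicator_of_notMem]
      exact fun h' => hx (iUnion₂_subset_iUnion _ _ h')

/-- A family of linear functionals on bounded measurable functions, uniformly bounded over
`r ∈ [0, 1]` and continuous under bounded pointwise convergence. -/
structure IsBoundedFamily (Λ : (ℝ → ℂ) → ℝ → ℂ) : Prop where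
  add : ∀ {f g}, BddMeas f → BddMeas g → ∀ r, Λ (fun x => f x + g x) r = Λ f r + Λ g r
  const_mul : ∀ {f}, BddMeas f → ∀ c r, Λ (fun x => c * f x) r = c * Λ f r
  bound : ∀ C, ∃ K, ∀ f, Measurable f → (∀ x, ‖f x‖ ≤ C) → ∀ r ∈ Icc (0 : ℝ) 1, ‖Λ f r‖ ≤ K
  tendsto : ∀ {f : ℕ → ℝ → ℂ} {F : ℝ → ℂ} {C : ℝ}, (∀ n, Measurable (f n)) →
    (∀ n x, ‖f n x‖ ≤ C) → (∀ x, Tendsto (fun n => f n x) atTop (𝓝 (F x))) →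
    ∀ r, Tendsto (fun n => Λ (f n) r) atTop (𝓝 (Λ F r))

namespace IsBoundedFamily

lemma of_trace {T : ℝ → 𝓗 →L[ℂ] 𝓗} {H : ℝ → SelfAdjointOperator 𝓗} (E : ∀ r, SpectralMeasure (H r))
    (hT : ∀ r, IsTraceClass (T r)) {K : ℝ} (hK0 : 0 ≤ K)
    (hK : ∀ r ∈ Icc (0 : ℝ) 1, ∀ A, ‖trace (T r * A)‖ ≤ K * ‖A‖)
    {u : ℝ → ℝ} (hu : Measurable u) {w : ℝ → ℂ} (hw : BddMeas w) :
    IsBoundedFamily fun f r => trace (T r * (E r).fc fun x => f (u x) * w x) where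
  add {f g} hf hg r := by
    simp only [add_mul]
    rw [(E r).fc_add ((hf.comp hu).mul hw) ((hg.comp hu).mul hw), mul_add,
      trace_add ((hT r).mul_right _) ((hT r).mul_right _)]
  const_mul {f} hf c r := by
    simp only [mul_assoc]
    rw [(E r).fc_const_mul ((hf.comp hu).mul hw), mul_smul_comm, trace_smul]
  bound C := by
    obtain ⟨D, hD0, hD⟩ := hw.bound
    refine ⟨K * (C * D), fun f hf hC r hr => (hK r hr _).trans ?_⟩
    have hfb : BddMeas f := ⟨hf, C, hC⟩
    refine mul_le_mul_of_nonneg_left ((E r).norm_fc_le ((hfb.comp hu).mul hw) fun x => ?_) hK0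
    rw [norm_mul]
    exact mul_le_mul (hC _) (hD x) (norm_nonneg _) ((norm_nonneg _).trans (hC 0))
  tendsto {f F C} hf hC hl r := by
    obtain ⟨D, hD0, hD⟩ := hw.bound
    have hm : ∀ n, BddMeas fun x => f n (u x) * w x := fun n =>
      (BddMeas.comp ⟨hf n, C, hC n⟩ hu).mul hw
    have hb : ∀ n x, ‖f n (u x) * w x‖ ≤ C * D := fun n x => by
      rw [norm_mul]
      exact mul_le_mul (hC n _) (hD x) (norm_nonneg _) ((norm_nonneg _).trans (hC n 0))
    exact tendsto_trace_mul (hT r) (fun n => (E r).norm_fc_le (hm n) (hb n))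
      ((E r).tendsto_fc_inner (fun n => (hm n).1) hb fun x => (hl (u x)).mul_const _)

/-- Two bounded families whose integrals over `[0, 1]` agree on derivatives of test functions have
the same integrals on all bounded measurable functions. -/
lemma integral_eq {Λ Λ' : (ℝ → ℂ) → ℝ → ℂ} (h : IsBoundedFamily Λ) (h' : IsBoundedFamily Λ')
    (hderiv : ∀ ψ : ℝ → ℝ, ContDiff ℝ (⊤ : ℕ∞) ψ → HasCompactSupport ψ →
      ContinuousOn (Λ fun x => ((deriv ψ x : ℝ) : ℂ)) (Icc 0 1) ∧
      ContinuousOn (Λ' fun x => ((deriv ψ x : ℝ) : ℂ)) (Icc 0 1) ∧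
      ∫ r in (0 : ℝ)..1, Λ (fun x => ((deriv ψ x : ℝ) : ℂ)) r
        = ∫ r in (0 : ℝ)..1, Λ' (fun x => ((deriv ψ x : ℝ) : ℂ)) r)
    {f : ℝ → ℂ} (hf : BddMeas f) : ∫ r in (0 : ℝ)..1, Λ f r = ∫ r in (0 : ℝ)..1, Λ' f r := by
  have hlim : ∀ {Λ : (ℝ → ℂ) → ℝ → ℂ}, IsBoundedFamily Λ → ∀ {f : ℕ → ℝ → ℂ} {F : ℝ → ℂ} {C : ℝ},
      (∀ n, Measurable (f n)) → (∀ n x, ‖f n x‖ ≤ C) →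
      (∀ x, Tendsto (fun n => f n x) atTop (𝓝 (F x))) →
      (∀ n, IntervalIntegrable (Λ (f n)) volume 0 1) → IntervalIntegrable (Λ F) volume 0 1 ∧
      Tendsto (fun n => ∫ r in (0 : ℝ)..1, Λ (f n) r) atTop (𝓝 (∫ r in (0 : ℝ)..1, Λ F r)) := by
    intro Λ h f F C hm hC hl hi
    obtain ⟨K, hK⟩ := h.bound C
    have hF := BddMeas.of_tendsto hm hC hl
    have hFC : ∀ x, ‖F x‖ ≤ C := fun x =>
      le_of_tendsto (hl x).norm (Eventually.of_forall fun n => hC n x)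
    have hs : ∀ r ∈ uIoc (0 : ℝ) 1, r ∈ Icc (0 : ℝ) 1 := fun r hr => by
      rw [uIoc_of_le zero_le_one] at hr
      exact Ioc_subset_Icc_self hr
    constructor
    · refine (intervalIntegrable_const (c := K)).mono_fun ?_ ?_
      · exact aestronglyMeasurable_of_tendsto_ae atTop (fun n => (hi n).def'.aestronglyMeasurable)
          (Eventually.of_forall fun r => h.tendsto hm hC hl r)
      · refine (ae_restrict_mem measurableSet_uIoc).mono fun r hr => ?_
        exact (hK F hF.1 hFC r (hs r hr)).trans (le_abs_self K)
    · exact intervalIntegral.tendsto_integral_filter_of_dominated_convergence (fun _ => K)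
        (Eventually.of_forall fun n => (hi n).def'.aestronglyMeasurable)
        (Eventually.of_forall fun n => Eventually.of_forall fun r hr =>
          hK (f n) (hm n) (hC n) r (hs r hr))
        intervalIntegrable_const (Eventually.of_forall fun r _ => h.tendsto hm hC hl r)
  have hicc : uIcc (0 : ℝ) 1 = Icc 0 1 := uIcc_of_le zero_le_one
  refine (hf.induction_deriv (p := fun f => IntervalIntegrable (Λ f) volume 0 1 ∧
    IntervalIntegrable (Λ' f) volume 0 1 ∧ ∫ r in (0 : ℝ)..1, Λ f r = ∫ r in (0 : ℝ)..1, Λ' f r)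
    ?_ ?_ ?_ ?_).2.2
  · intro ψ hψ hc
    obtain ⟨h1, h2, h3⟩ := hderiv ψ hψ hc
    exact ⟨(hicc ▸ h1).intervalIntegrable, (hicc ▸ h2).intervalIntegrable, h3⟩
  · rintro f g hf hg ⟨f1, f2, f3⟩ ⟨g1, g2, g3⟩
    rw [funext (h.add hf hg), funext (h'.add hf hg)]
    refine ⟨f1.add g1, f2.add g2, ?_⟩
    rw [intervalIntegral.integral_add f1 g1, intervalIntegral.integral_add f2 g2, f3, g3]
  · rintro c f hf ⟨f1, f2, f3⟩
    rw [funext (h.const_mul hf c), funext (h'.const_mul hf c)]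
    refine ⟨f1.const_mul c, f2.const_mul c, ?_⟩
    rw [intervalIntegral.integral_const_mul, intervalIntegral.integral_const_mul, f3]
  · intro f F C hm hC hl hp
    obtain ⟨i1, t1⟩ := hlim h hm hC hl fun n => (hp n).1
    obtain ⟨i2, t2⟩ := hlim h' hm hC hl fun n => (hp n).2.1
    refine ⟨i1, i2, tendsto_nhds_unique t1 ?_⟩
    simpa only [fun n => (hp n).2.2] using t2

end IsBoundedFamily

lemma TracePath.trace_T_mul_fc_weight (P : TracePath 𝓗) (hV : IsTraceClass P.V) {g : ℝ → ℂ}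
    (hg : BddMeas g) (hc : HasCompactSupport g) (r : ℝ) :
    trace (P.T r * (P.E r).fc (weight g)) = trace (P.V * (P.E r).fc g) := by
  have hb : BddMeas fun x : ℝ => ((x : ℂ) - (-I))⁻¹ :=
    SpectralMeasure.bddMeas_resolvent (by simp)
  have hcomm : P.R r * (P.E r).fc (weight g) = (P.E r).fc (weight g) * P.R r := by
    rw [R_eq_fc, ← (P.E r).fc_mul hb (hg.weight hc), ← (P.E r).fc_mul (hg.weight hc) hb]
    simp only [mul_comm]
  have h1 : P.T r * (P.E r).fc (weight g) = P.R r * (P.V * (P.R r * (P.E r).fc (weight g))) := by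
    rw [T]; simp only [mul_assoc]
  rw [h1, trace_mul_comm (hV.mul_right _), P.fc_eq_R_mul_R_mul hg hc, mul_assoc, mul_assoc,
    ← hcomm]

lemma SpectralMeasure.trace_proj_mul {H : SelfAdjointOperator 𝓗} (E : SpectralMeasure H)
    {D : 𝓗 →L[ℂ] 𝓗} (hD : IsTraceClass D) {f : ℝ → ℂ} (hf : BddMeas f) :
    trace (E.proj (tsupport f) * (D * E.fc f)) = trace (D * E.fc f) := by
  have hK : MeasurableSet (tsupport f) := (isClosed_tsupport f).measurableSet
  rw [trace_mul_comm (hD.mul_right _), mul_assoc, ← E.fc_indicator hK, ← E.fc_mul hf (.indicator hK)]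
  congr 3
  ext x
  by_cases hx : x ∈ tsupport f
  · simp [hx]
  · simp [hx, image_eq_zero_of_notMem_tsupport hx]

/-- (Invariance principle.)  In the affine setting `𝒜 = H₀ + 𝒜₀`,
for `H₀, H₁ ∈ 𝒜` and a real-valued test function `φ`, the spectral shift measures `ξ`
of `(H₁, H₀)` and `ξ_φ` of `(φ(H₁), φ(H₀))` satisfy `ξ_φ(f) = ξ((f ∘ φ)·φ')` for every
bounded Borel function `f`. -/
theorem invariance_principle
    (𝓗 : Type) [NormedAddCommGroup 𝓗] [InnerProductSpace ℂ 𝓗] [CompleteSpace 𝓗]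
    (𝒜 : AffineSetting 𝓗)
    (E : ∀ V : 𝓗 →L[ℂ] 𝓗, SpectralMeasure (𝒜.opOf V))
    (W₀ W₁ : 𝓗 →L[ℂ] 𝓗) (hW₀ : W₀ ∈ 𝒜.A0) (hW₁ : W₁ ∈ 𝒜.A0)
    (φ : ℝ → ℝ) (hφ : ContDiff ℝ (⊤ : ℕ∞) φ) (hφc : HasCompactSupport φ)
    -- `B r` is the straight line path from `φ(H₀)` to `φ(H₁)`
    (B : ℝ → SelfAdjointOperator 𝓗)
    (hB0 : IsBoundedSAOpOf (B 0) ((E W₀).fcR φ))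
    (hB : ∀ r : ℝ, IsSum (B 0) ((r : ℂ) • ((E W₁).fcR φ - (E W₀).fcR φ)) (B r))
    (EB : ∀ r : ℝ, SpectralMeasure (B r))
    (f : ℝ → ℂ) (hf : Measurable f) (hfb : ∃ C, ∀ x, ‖f x‖ ≤ C) :
    -- `ξ_φ(f) = ξ((f ∘ φ)·φ')`
    (∫ r in (0:ℝ)..1,
        trace ((EB r).proj (tsupport f) ∘L
          ((((E W₁).fcR φ - (E W₀).fcR φ)) ∘L (EB r).fc f)))
      = ∫ r in (0:ℝ)..1,
          trace ((E (W₀ + (r : ℂ) • (W₁ - W₀))).proj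
              (tsupport fun x : ℝ => f (φ x) * ((deriv φ x : ℝ) : ℂ)) ∘L
            ((W₁ - W₀) ∘L
              (E (W₀ + (r : ℂ) • (W₁ - W₀))).fc
                fun x : ℝ => f (φ x) * ((deriv φ x : ℝ) : ℂ))) := by
  have hfm : BddMeas f := ⟨hf, hfb⟩
  have hφm : Measurable φ := hφ.continuous.measurable
  have hφb : BddMeas fun x => (φ x : ℂ) := bddMeas_ofReal hφ.continuous hφc
  have hφ' : ContDiff ℝ (⊤ : ℕ∞) (deriv φ) := (contDiff_infty_iff_deriv.1 hφ).2
  have hφ'b : BddMeas fun x => ((deriv φ x : ℝ) : ℂ) := bddMeas_ofReal hφ'.continuous hφc.deriv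
  have hφ'c : HasCompactSupport fun x => ((deriv φ x : ℝ) : ℂ) := hasCompactSupport_ofReal hφc.deriv
  let P := 𝒜.path E hW₀ hW₁
  have hE1 : ∀ ψ, (P.E 1).fcR ψ = (E W₁).fcR ψ := by
    have h1 : ∀ W, W = W₁ → ∀ ψ, (E W).fcR ψ = (E W₁).fcR ψ := by rintro _ rfl _; rfl
    exact h1 _ (by simp)
  have hE0 : ∀ ψ, (P.E 0).fcR ψ = (E W₀).fcR ψ := by
    have h1 : ∀ W, W = W₀ → ∀ ψ, (E W).fcR ψ = (E W₀).fcR ψ := by rintro _ rfl _; rfl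
    exact h1 _ (by simp)
  have hD : IsTraceClass ((E W₁).fcR φ - (E W₀).fcR φ) := by
    have h1 := (P.trace_formula hφ hφc).1
    rwa [hE1, hE0] at h1
  have hDsa : IsSelfAdjoint ((E W₁).fcR φ - (E W₀).fcR φ) :=
    ((E W₁).isSelfAdjoint_fcR hφb).sub ((E W₀).isSelfAdjoint_fcR hφb)
  let Q := TracePath.ofTraceClass EB hD hDsa hB
  have hB0' := hB0.resolvent_mul
  have hB1' := (hB 1).resolvent_mul hB0'
  rw [Complex.ofReal_one, one_smul, add_sub_cancel] at hB1'
  have hr0 := (E W₀).eq_fc_of_mul_eq_one hφb hφm hB0'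
  have hr1 := (E W₁).eq_fc_of_mul_eq_one hφb hφm hB1'
  set D := (E W₁).fcR φ - (E W₀).fcR φ with hDdef
  -- the two families whose integrals are to be compared
  have hL : IsBoundedFamily fun f r => trace (D * (EB r).fc fun x => f x * 1) :=
    .of_trace (T := fun _ => D) EB (fun _ => hD) (norm_nonneg (traceMul hD))
      (fun _ _ A => (traceMul hD).le_opNorm A) measurable_id (.const 1)
  obtain ⟨K, hK0, hK⟩ := P.exists_norm_trace_le
  have hR : IsBoundedFamily fun f r => trace (P.T r * (P.E r).fc fun x =>
      f (φ x) * weight (fun x => ((deriv φ x : ℝ) : ℂ)) x) :=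
    .of_trace P.E P.isTraceClass_T hK0 hK hφm (hφ'b.weight hφ'c)
  have hRw : ∀ f : ℝ → ℂ, (fun x => f (φ x) * weight (fun x => ((deriv φ x : ℝ) : ℂ)) x)
      = weight fun x => f (φ x) * ((deriv φ x : ℝ) : ℂ) := fun f => by
    ext x
    simp only [weight, mul_assoc]
  have hmain := hL.integral_eq hR (fun ψ hψ hψc => ?_) hfm
  · have h1 : ∀ r, trace ((EB r).proj (tsupport f) ∘L (D ∘L (EB r).fc f))
        = trace (D * (EB r).fc fun x => f x * 1) := fun r => by
      simp only [mul_one]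
      exact (EB r).trace_proj_mul hD hfm
    have hgb : BddMeas fun x => f (φ x) * ((deriv φ x : ℝ) : ℂ) := (hfm.comp hφm).mul hφ'b
    have hgc : HasCompactSupport fun x => f (φ x) * ((deriv φ x : ℝ) : ℂ) := hφ'c.mul_left
    simp only [h1]
    rw [hmain]
    refine intervalIntegral.integral_congr fun r _ => ?_
    simp only [hRw]
    exact (P.trace_proj_mul hgb hgc r).symm
  · have hψ' : ContDiff ℝ (⊤ : ℕ∞) (deriv ψ) := (contDiff_infty_iff_deriv.1 hψ).2
    have hψ'b := bddMeas_ofReal hψ'.continuous hψc.deriv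
    have hψ'c := hasCompactSupport_ofReal hψc.deriv
    have hψb := bddMeas_ofReal hψ.continuous hψc
    let χ : ℝ → ℝ := fun x => ψ (φ x) - ψ 0
    have hχ : ContDiff ℝ (⊤ : ℕ∞) χ := (hψ.comp hφ).sub contDiff_const
    have hχc : HasCompactSupport χ := by
      refine HasCompactSupport.intro hφc.isCompact fun x hx => ?_
      simp [χ, image_eq_zero_of_notMem_tsupport hx]
    have hχd : ∀ x, deriv χ x = deriv ψ (φ x) * deriv φ x := fun x => by
      have h1 := ((hψ.differentiable (by simp) (φ x)).hasDerivAt.comp x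
        (hφ.differentiable (by simp) x).hasDerivAt).sub_const (ψ 0)
      exact h1.deriv
    have hχE : ∀ {H : SelfAdjointOperator 𝓗} (E : SpectralMeasure H),
        E.fcR χ = E.fcR (fun x => ψ (φ x)) - (ψ 0 : ℂ) • 1 := fun E => by
      have h1 := E.fc_sub (hψb.comp hφm) ((BddMeas.const 1).const_mul (ψ 0 : ℂ))
      rw [E.fc_const_mul (.const 1), E.fc_one] at h1
      simpa [SpectralMeasure.fcR, χ] using h1
    obtain ⟨-, hQc, hQ⟩ := Q.trace_formula hψ hψc
    obtain ⟨-, hPc, hP⟩ := P.trace_formula hχ hχc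
    have h1 : ∀ r, trace (Q.T r * (Q.E r).fc (weight fun x => ((deriv ψ x : ℝ) : ℂ)))
        = trace (D * (EB r).fc fun x => ((deriv ψ x : ℝ) : ℂ) * 1) := fun r => by
      simp only [mul_one]
      exact Q.trace_T_mul_fc_weight hD hψ'b hψ'c r
    have h2 : (weight fun x => ((deriv χ x : ℝ) : ℂ)) = fun x => ((deriv ψ (φ x) : ℝ) : ℂ) *
        weight (fun x => ((deriv φ x : ℝ) : ℂ)) x := by
      rw [hRw fun x => ((deriv ψ x : ℝ) : ℂ)]
      simp only [hχd, Complex.ofReal_mul]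
    simp only [h1] at hQc hQ
    simp only [h2] at hPc hP
    refine ⟨hQc, hPc, hQ.symm.trans (Eq.trans ?_ hP)⟩
    rw [hE1, hE0, hχE, hχE, sub_sub_sub_cancel_right,
      ← (E W₀).fcR_eq_of_resolvent (EB 0) hφm hr0 hψ hψc,
      ← (E W₁).fcR_eq_of_resolvent (EB 1) hφm hr1 hψ hψc]
    rfl

end SSF
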